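/- arXiv:1704.05339 — 2 statements merged into one kernel-verified Lean document; each statement's English description precedes it below -/
import Mathlib

section
/- Space-time trace estimate on a boundary annulus: for every ψ ∈ C¹(closure(B₁) × [0,1]) and r ≤ 1, (∫₀¹∫_{∂B₁}(ψ−ψ̄)²)^{1/2} ≤ C(d) [ r^{1/2} (∫₀¹∫_{A_r}|∇ψ|²)^{1/2} + r^{−(d+1)/2} ∫₀¹∫_{A_r} |∂_t ψ| ], where ψ̄(x) := ∫₀¹ ψ(t,x) dt and A_r := B₁ \ B_{1−r}. -/
open MeasureTheory Metric

noncomputable section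

/-- The surface measure on the unit sphere of `ℝᵈ`. -/
def sphereMeasure (d : ℕ) : Measure (EuclideanSpace ℝ (Fin d)) :=
  (μH[(d : ℝ) - 1]).restrict (Metric.sphere (0 : EuclideanSpace ℝ (Fin d)) 1)

open scoped ENNReal NNReal

/-- A spherical cap on which a fixed coordinate has sign `ε` and is bounded away from zero. -/
def sphericalCap (n : ℕ) (i : Fin (n + 1)) (ε : ℝ) : Set (EuclideanSpace ℝ (Fin (n + 1))) :=
  {x | ‖x‖ = 1 ∧ 1 ≤ (n + 1) * (ε * x i)}

theorem exists_mem_sphericalCap {n : ℕ} {x : EuclideanSpace ℝ (Fin (n + 1))} (hx : ‖x‖ = 1) :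
    ∃ i, x ∈ sphericalCap n i 1 ∪ sphericalCap n i (-1) := by
  have hsum : ∑ i, x i ^ 2 = 1 := by
    rw [← EuclideanSpace.real_norm_sq_eq, hx, one_pow]
  have hn : (0 : ℝ) < n + 1 := by positivity
  obtain ⟨i, -, hi⟩ : ∃ i ∈ Finset.univ, (1 : ℝ) / (n + 1) ≤ x i ^ 2 := by
    apply Finset.exists_le_of_sum_le Finset.univ_nonempty
    rw [hsum]
    simp [hn.ne']
  have hi' : 1 ≤ (n + 1) * |x i| := by
    rw [div_le_iff₀' hn] at hi
    by_contra! h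
    have h0 := abs_nonneg (x i)
    have h1 : |x i| ≤ (n + 1) * |x i| := by
      nlinarith [(Nat.cast_nonneg n : (0 : ℝ) ≤ n)]
    rw [← sq_abs] at hi
    nlinarith
  refine ⟨i, ?_⟩
  rcases abs_cases (x i) with ⟨h, -⟩ | ⟨h, -⟩
  · left; exact ⟨hx, by rw [h] at hi'; linarith⟩
  · right; exact ⟨hx, by rw [h] at hi'; linarith⟩

theorem abs_apply_le_norm {n : ℕ} (x : EuclideanSpace ℝ (Fin n)) (i : Fin n) : |x i| ≤ ‖x‖ := by
  simpa using PiLp.norm_apply_le x i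

theorem norm_le_sum_abs {n : ℕ} (x : EuclideanSpace ℝ (Fin n)) : ‖x‖ ≤ ∑ i, |x i| := by
  have h : 0 ≤ ∑ i, |x i| := Finset.sum_nonneg fun i _ => abs_nonneg _
  refine le_of_sq_le_sq ?_ h
  rw [EuclideanSpace.real_norm_sq_eq]
  simpa using Finset.sum_sq_le_sq_sum_of_nonneg (s := Finset.univ) (f := fun i => |x i|)
    (fun i _ => abs_nonneg _)

/-- On a cap, the projection forgetting the distinguished coordinate is bi-Lipschitz. -/
theorem antilipschitz_sphericalCap (n : ℕ) (i : Fin (n + 1)) (ε : ℝ) (hε : |ε| = 1) :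
    AntilipschitzWith ((n : ℝ≥0) * (n + 2))
      (fun (x : sphericalCap n i ε) (j : Fin n) => x.1 (i.succAbove j)) := by
  apply AntilipschitzWith.of_le_mul_dist
  rintro ⟨x, hx, hxi⟩ ⟨y, hy, hyi⟩
  set D := dist (fun j : Fin n => x (i.succAbove j)) (fun j : Fin n => y (i.succAbove j))
  have hD : 0 ≤ D := dist_nonneg
  have hj (j : Fin n) : |x (i.succAbove j) - y (i.succAbove j)| ≤ D := by
    rw [← Real.dist_eq]
    exact dist_le_pi_dist (fun j : Fin n => x (i.succAbove j)) (fun j => y (i.succAbove j)) j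
  have hx2 : x i ^ 2 + ∑ j, x (i.succAbove j) ^ 2 = 1 := by
    rw [← Fin.sum_univ_succAbove (fun k => x k ^ 2), ← EuclideanSpace.real_norm_sq_eq, hx, one_pow]
  have hy2 : y i ^ 2 + ∑ j, y (i.succAbove j) ^ 2 = 1 := by
    rw [← Fin.sum_univ_succAbove (fun k => y k ^ 2), ← EuclideanSpace.real_norm_sq_eq, hy, one_pow]
  have hsum : |∑ j, (x (i.succAbove j) ^ 2 - y (i.succAbove j) ^ 2)| ≤ n * (2 * D) := by
    refine (Finset.abs_sum_le_sum_abs _ _).trans ?_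
    refine (Finset.sum_le_card_nsmul _ _ (2 * D) fun j _ => ?_).trans (by simp)
    rw [sq_sub_sq, abs_mul]
    have h1 := abs_apply_le_norm x (i.succAbove j)
    have h2 := abs_apply_le_norm y (i.succAbove j)
    rw [hx] at h1
    rw [hy] at h2
    have h3 := abs_add_le (x (i.succAbove j)) (y (i.succAbove j))
    exact mul_le_mul (by linarith) (hj j) (abs_nonneg _) (by norm_num)
  have hi : |x i - y i| ≤ n * (n + 1) * D := by
    have h1 : (x i + y i) * (x i - y i) =
        -∑ j, (x (i.succAbove j) ^ 2 - y (i.succAbove j) ^ 2) := by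
      rw [Finset.sum_sub_distrib]; linarith
    have h2 : |x i + y i| * |x i - y i| ≤ n * (2 * D) := by
      rw [← abs_mul, h1, abs_neg]; exact hsum
    have h3 : 2 ≤ (n + 1) * |x i + y i| := by
      have : ε * (x i + y i) ≤ |x i + y i| := by
        refine (le_abs_self _).trans ?_
        rw [abs_mul, hε, one_mul]
      have hn : (0 : ℝ) < n + 1 := by positivity
      nlinarith
    have h4 : 2 * |x i - y i| ≤ (n + 1) * |x i + y i| * |x i - y i| :=
      mul_le_mul_of_nonneg_right h3 (abs_nonneg _)
    have hn : (0 : ℝ) < n + 1 := by positivity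
    nlinarith [mul_le_mul_of_nonneg_left h2 hn.le]
  have key : ‖x - y‖ ≤ n * (n + 2) * D := by
    refine (norm_le_sum_abs _).trans ?_
    rw [Fin.sum_univ_succAbove _ i]
    have : ∑ j, |(x - y) (i.succAbove j)| ≤ n * D := by
      refine (Finset.sum_le_card_nsmul _ _ D fun j _ => ?_).trans (by simp)
      simpa using hj j
    have h5 : |(x - y) i| ≤ n * (n + 1) * D := by simpa using hi
    linarith
  rw [Subtype.dist_eq, dist_eq_norm]
  simpa using key

theorem hausdorffMeasure_sphericalCap_inter_le (n : ℕ) (i : Fin (n + 1)) (ε : ℝ) (hε : |ε| = 1)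
    (z : EuclideanSpace ℝ (Fin (n + 1))) {ρ : ℝ} (hρ : 0 ≤ ρ) :
    μH[(n : ℝ)] (sphericalCap n i ε ∩ closedBall z ρ) ≤
      (((n : ℝ≥0) * (n + 2) : ℝ≥0) : ℝ≥0∞) ^ (n : ℝ) * ENNReal.ofReal (2 * ρ) ^ n := by
  let f : sphericalCap n i ε → Fin n → ℝ := fun x j => x.1 (i.succAbove j)
  let p : Fin n → ℝ := fun j => z (i.succAbove j)
  have hsub : sphericalCap n i ε ∩ closedBall z ρ ⊆ Subtype.val '' (f ⁻¹' closedBall p ρ) := by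
    rintro x ⟨hx, hxz⟩
    refine ⟨⟨x, hx⟩, ?_, rfl⟩
    rw [Set.mem_preimage, mem_closedBall, dist_pi_le_iff hρ]
    intro j
    have := abs_apply_le_norm (x - z) (i.succAbove j)
    rw [mem_closedBall, dist_eq_norm] at hxz
    simpa [f, p, Real.dist_eq] using this.trans hxz
  calc μH[(n : ℝ)] (sphericalCap n i ε ∩ closedBall z ρ)
      ≤ μH[(n : ℝ)] (Subtype.val '' (f ⁻¹' closedBall p ρ)) := measure_mono hsub
    _ = μH[(n : ℝ)] (f ⁻¹' closedBall p ρ) :=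
      isometry_subtype_coe.hausdorffMeasure_image (Or.inl (Nat.cast_nonneg n)) _
    _ ≤ _ * μH[(n : ℝ)] (closedBall p ρ) :=
      (antilipschitz_sphericalCap n i ε hε).hausdorffMeasure_preimage_le (Nat.cast_nonneg n) _
    _ = _ := by
      have h : (μH[(n : ℝ)] : Measure (Fin n → ℝ)) = volume := by
        simpa using hausdorffMeasure_pi_real (ι := Fin n)
      rw [h, Real.volume_pi_closedBall p hρ, Fintype.card_fin,
        ENNReal.ofReal_pow (by positivity)]

/-- Upper Ahlfors regularity of the surface measure. -/
theorem exists_sphereMeasure_closedBall_le (n : ℕ) :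
    ∃ K : ℝ≥0∞, K ≠ ∞ ∧ ∀ (z : EuclideanSpace ℝ (Fin (n + 1))) (ρ : ℝ), 0 ≤ ρ →
      sphereMeasure (n + 1) (closedBall z ρ) ≤ K * ENNReal.ofReal ρ ^ n := by
  let L : ℝ≥0∞ := (((n : ℝ≥0) * (n + 2) : ℝ≥0) : ℝ≥0∞) ^ (n : ℝ)
  have hL : L ≠ ∞ := ENNReal.rpow_ne_top_of_nonneg (Nat.cast_nonneg n) ENNReal.coe_ne_top
  refine ⟨(n + 1) * (L * 2 ^ n + L * 2 ^ n), by finiteness, fun z ρ hρ => ?_⟩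
  have hcap (i : Fin (n + 1)) (ε : ℝ) (hε : |ε| = 1) :
      μH[(n : ℝ)] (sphericalCap n i ε ∩ closedBall z ρ) ≤ L * 2 ^ n * ENNReal.ofReal ρ ^ n := by
    refine (hausdorffMeasure_sphericalCap_inter_le n i ε hε z hρ).trans_eq ?_
    rw [ENNReal.ofReal_mul (by norm_num), mul_pow, mul_assoc]
    simp [L]
  rw [sphereMeasure, Measure.restrict_apply measurableSet_closedBall]
  have hd : (((n + 1 : ℕ) : ℝ) - 1) = n := by push_cast; ring
  rw [hd]
  have hsub : closedBall z ρ ∩ sphere 0 1 ⊆ ⋃ i : Fin (n + 1),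
      ((sphericalCap n i 1 ∩ closedBall z ρ) ∪ (sphericalCap n i (-1) ∩ closedBall z ρ)) := by
    rintro x ⟨hxz, hx⟩
    obtain ⟨i, hi⟩ := exists_mem_sphericalCap (mem_sphere_zero_iff_norm.1 hx)
    exact Set.mem_iUnion.2 ⟨i, hi.imp (⟨·, hxz⟩) (⟨·, hxz⟩)⟩
  calc _ ≤ ∑ i : Fin (n + 1), μH[(n : ℝ)] ((sphericalCap n i 1 ∩ closedBall z ρ) ∪
        (sphericalCap n i (-1) ∩ closedBall z ρ)) :=
        (measure_mono hsub).trans (measure_iUnion_fintype_le _ _)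
    _ ≤ ∑ i : Fin (n + 1), (L * 2 ^ n + L * 2 ^ n) * ENNReal.ofReal ρ ^ n := by
      refine Finset.sum_le_sum fun i _ => (measure_union_le _ _).trans ?_
      rw [add_mul]
      exact add_le_add (hcap i 1 (by simp)) (hcap i (-1) (by simp))
    _ = _ := by simp [mul_assoc]

theorem isFiniteMeasure_sphereMeasure (n : ℕ) : IsFiniteMeasure (sphereMeasure (n + 1)) := by
  obtain ⟨K, hK, h⟩ := exists_sphereMeasure_closedBall_le n
  refine ⟨?_⟩
  have hu : sphereMeasure (n + 1) Set.univ ≤ sphereMeasure (n + 1) (closedBall 0 1) := by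
    rw [sphereMeasure, Measure.restrict_apply_univ, Measure.restrict_apply measurableSet_closedBall,
      Set.inter_eq_right.2 sphere_subset_closedBall]
  exact hu.trans_lt ((h 0 1 zero_le_one).trans_lt (by simpa using hK.lt_top))

/-- The normalized volume on the unit ball. -/
def unitBallAverage (n : ℕ) : Measure (EuclideanSpace ℝ (Fin (n + 1))) :=
  (volume (ball (0 : EuclideanSpace ℝ (Fin (n + 1))) 1))⁻¹ •
    volume.restrict (ball (0 : EuclideanSpace ℝ (Fin (n + 1))) 1)

theorem volume_unitBall_ne_zero (n : ℕ) :
    volume (ball (0 : EuclideanSpace ℝ (Fin (n + 1))) 1) ≠ 0 :=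
  (measure_ball_pos _ _ one_pos).ne'

instance isProbabilityMeasure_unitBallAverage (n : ℕ) :
    IsProbabilityMeasure (unitBallAverage n) := by
  refine ⟨?_⟩
  simp only [unitBallAverage, Measure.smul_apply, Measure.restrict_apply_univ, smul_eq_mul]
  exact ENNReal.inv_mul_cancel (volume_unitBall_ne_zero n) measure_ball_lt_top.ne

theorem ae_unitBallAverage_mem_ball (n : ℕ) : ∀ᵐ w ∂(unitBallAverage n), w ∈ ball 0 1 :=
  Measure.ae_smul_measure (ae_restrict_mem measurableSet_ball) _

theorem ae_sphereMeasure_mem_sphere (d : ℕ) : ∀ᵐ x ∂(sphereMeasure d), x ∈ sphere 0 1 :=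
  ae_restrict_mem isClosed_sphere.measurableSet

/-- The annulus `B₁ \ B_{1 - r}`. -/
def annulus (n : ℕ) (r : ℝ) : Set (EuclideanSpace ℝ (Fin (n + 1))) := ball 0 1 \ ball 0 (1 - r)

theorem ball_subset_annulus {n : ℕ} {x : EuclideanSpace ℝ (Fin (n + 1))} (hx : x ∈ sphere 0 1)
    {ρ r : ℝ} (hρr : 2 * ρ ≤ r) (hr : r ≤ 1) :
    ball ((1 - ρ) • x) ρ ⊆ annulus n r ∩ closedBall x (2 * ρ) := by
  intro z hz
  have hρ : 0 < ρ := pos_of_mem_ball hz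
  rw [mem_sphere_zero_iff_norm] at hx
  rw [mem_ball, dist_eq_norm] at hz
  have hn : ‖(1 - ρ) • x‖ = 1 - ρ := by
    rw [norm_smul, hx, mul_one, Real.norm_of_nonneg (by linarith)]
  have hn' : ‖(1 - ρ) • x - x‖ = ρ := by
    rw [sub_smul, one_smul, sub_sub_cancel_left, norm_neg, norm_smul, hx, mul_one,
      Real.norm_of_nonneg hρ.le]
  have h1 := norm_sub_norm_le z ((1 - ρ) • x)
  have h2 := norm_sub_norm_le ((1 - ρ) • x) z
  rw [norm_sub_rev] at h2
  have h3 := norm_sub_le_norm_sub_add_norm_sub z ((1 - ρ) • x) x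
  refine ⟨⟨?_, ?_⟩, ?_⟩
  · rw [mem_ball_zero_iff]; linarith
  · rw [mem_ball_zero_iff, not_lt]; linarith
  · rw [mem_closedBall, dist_eq_norm]; linarith

theorem setLIntegral_unitBall_comp {n : ℕ} (a : EuclideanSpace ℝ (Fin (n + 1))) {ρ : ℝ}
    (hρ : 0 < ρ) {g : EuclideanSpace ℝ (Fin (n + 1)) → ℝ≥0∞} (hg : Measurable g) :
    ∫⁻ w in ball 0 1, g (a + ρ • w) =
      (ENNReal.ofReal ρ ^ (n + 1))⁻¹ * ∫⁻ z in ball a ρ, g z := by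
  have hind : Measurable ((ball a ρ).indicator g) := hg.indicator measurableSet_ball
  calc ∫⁻ w in ball 0 1, g (a + ρ • w)
      = ∫⁻ w, (ball a ρ).indicator g (a + ρ • w) := by
        rw [← lintegral_indicator measurableSet_ball]
        refine lintegral_congr fun w => ?_
        have : a + ρ • w ∈ ball a ρ ↔ w ∈ ball (0 : EuclideanSpace ℝ (Fin (n + 1))) 1 := by
          simp [norm_smul, abs_of_pos hρ, hρ]
        by_cases hw : w ∈ ball (0 : EuclideanSpace ℝ (Fin (n + 1))) 1
        · rw [Set.indicator_of_mem hw, Set.indicator_of_mem (this.2 hw)]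
        · rw [Set.indicator_of_notMem hw, Set.indicator_of_notMem (mt this.1 hw)]
    _ = ∫⁻ u, (ball a ρ).indicator g (a + u)
          ∂(Measure.map (fun w : EuclideanSpace ℝ (Fin (n + 1)) => ρ • w) volume) := by
        rw [lintegral_map (by fun_prop) (by fun_prop)]
    _ = (ENNReal.ofReal ρ ^ (n + 1))⁻¹ * ∫⁻ z in ball a ρ, g z := by
        rw [Measure.map_addHaar_smul _ hρ.ne', lintegral_smul_measure,
          lintegral_add_left_eq_self, lintegral_indicator measurableSet_ball, abs_of_pos
          (by positivity), ENNReal.ofReal_inv_of_pos (by positivity), ENNReal.ofReal_pow hρ.le]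
        simp

theorem lintegral_unitBallAverage_comp {n : ℕ} (a : EuclideanSpace ℝ (Fin (n + 1))) {ρ : ℝ}
    (hρ : 0 < ρ) {g : EuclideanSpace ℝ (Fin (n + 1)) → ℝ≥0∞} (hg : Measurable g) :
    ∫⁻ w, g (a + ρ • w) ∂(unitBallAverage n) =
      (volume (ball (0 : EuclideanSpace ℝ (Fin (n + 1))) 1))⁻¹ *
        (ENNReal.ofReal ρ ^ (n + 1))⁻¹ * ∫⁻ z in ball a ρ, g z := by
  rw [unitBallAverage, lintegral_smul_measure, setLIntegral_unitBall_comp a hρ hg, smul_eq_mul,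
    mul_assoc]

theorem lintegral_unitBallAverage_le {n : ℕ} {x : EuclideanSpace ℝ (Fin (n + 1))}
    (hx : x ∈ sphere 0 1) {ρ r : ℝ} (hρ : 0 < ρ) (hρr : 2 * ρ ≤ r) (hr : r ≤ 1)
    {g : EuclideanSpace ℝ (Fin (n + 1)) → ℝ≥0∞} (hg : Measurable g) :
    ∫⁻ w, g ((1 - ρ) • x + ρ • w) ∂(unitBallAverage n) ≤
      (volume (ball (0 : EuclideanSpace ℝ (Fin (n + 1))) 1))⁻¹ *
        (ENNReal.ofReal ρ ^ (n + 1))⁻¹ * ∫⁻ z in annulus n r, g z := by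
  rw [lintegral_unitBallAverage_comp _ hρ hg]
  gcongr
  exact (ball_subset_annulus hx hρr hr).trans Set.inter_subset_left

theorem lintegral_sphereMeasure_unitBallAverage_le {n : ℕ} {K : ℝ≥0∞}
    (hK : ∀ (z : EuclideanSpace ℝ (Fin (n + 1))) (ρ : ℝ), 0 ≤ ρ →
      sphereMeasure (n + 1) (closedBall z ρ) ≤ K * ENNReal.ofReal ρ ^ n)
    {ρ r : ℝ} (hρ : 0 < ρ) (hρr : 2 * ρ ≤ r) (hr : r ≤ 1)
    {g : EuclideanSpace ℝ (Fin (n + 1)) → ℝ≥0∞} (hg : Measurable g) :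
    ∫⁻ x, ∫⁻ w, g ((1 - ρ) • x + ρ • w) ∂(unitBallAverage n) ∂(sphereMeasure (n + 1)) ≤
      (volume (ball (0 : EuclideanSpace ℝ (Fin (n + 1))) 1))⁻¹ * (K * 2 ^ n) *
        (ENNReal.ofReal ρ)⁻¹ * ∫⁻ z in annulus n r, g z := by
  have := isFiniteMeasure_sphereMeasure n
  set b := (volume (ball (0 : EuclideanSpace ℝ (Fin (n + 1))) 1))⁻¹
  set R := ENNReal.ofReal ρ
  have hR0 : R ≠ 0 := by simpa [R] using hρ
  have hRt : R ≠ ∞ := ENNReal.ofReal_ne_top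
  let N : Set (EuclideanSpace ℝ (Fin (n + 1)) × EuclideanSpace ℝ (Fin (n + 1))) :=
    {p | dist p.1 p.2 ≤ 2 * ρ}
  have hN : MeasurableSet N := measurableSet_le (by fun_prop) (by fun_prop)
  have hmeas : Measurable (N.indicator fun p => g p.2) := (hg.comp measurable_snd).indicator hN
  calc ∫⁻ x, ∫⁻ w, g ((1 - ρ) • x + ρ • w) ∂(unitBallAverage n) ∂(sphereMeasure (n + 1))
      ≤ ∫⁻ x, b * (R ^ (n + 1))⁻¹ *
          (∫⁻ z in annulus n r, N.indicator (fun p => g p.2) (x, z)) ∂(sphereMeasure (n + 1)) := by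
        refine lintegral_mono_ae ?_
        filter_upwards [ae_sphereMeasure_mem_sphere (n + 1)] with x hx
        rw [lintegral_unitBallAverage_comp _ hρ hg]
        refine mul_le_mul' le_rfl ?_
        have h1 (z) : N.indicator (fun p => g p.2) (x, z) =
            (closedBall x (2 * ρ)).indicator g z := by
          simp only [Set.indicator, N, Set.mem_ofPred_eq, mem_closedBall, dist_comm x z]
        simp_rw [h1]
        rw [lintegral_indicator measurableSet_closedBall,
          Measure.restrict_restrict measurableSet_closedBall, Set.inter_comm]
        exact lintegral_mono_set (ball_subset_annulus hx hρr hr)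
    _ = b * (R ^ (n + 1))⁻¹ * ∫⁻ z in annulus n r,
          ∫⁻ x, N.indicator (fun p => g p.2) (x, z) ∂(sphereMeasure (n + 1)) := by
        rw [lintegral_const_mul _ (hmeas.lintegral_prod_right'),
          lintegral_lintegral_swap
          (f := fun x z => N.indicator (fun p => g p.2) (x, z)) hmeas.aemeasurable]
    _ ≤ b * (R ^ (n + 1))⁻¹ * ∫⁻ z in annulus n r, (K * 2 ^ n * R ^ n) * g z := by
        gcongr with z
        have h1 (x) : N.indicator (fun p => g p.2) (x, z) =
            (closedBall z (2 * ρ)).indicator (fun _ => g z) x := by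
          simp only [Set.indicator, N, Set.mem_ofPred_eq, mem_closedBall]
        simp_rw [h1]
        rw [lintegral_indicator_const measurableSet_closedBall, mul_comm]
        gcongr
        refine (hK z (2 * ρ) (by positivity)).trans_eq ?_
        rw [ENNReal.ofReal_mul (by norm_num), mul_pow, mul_assoc]
        simp [R]
    _ = _ := by
        rw [lintegral_const_mul _ hg]
        have : (R ^ (n + 1))⁻¹ * R ^ n = R⁻¹ := by
          rw [pow_succ, ENNReal.mul_inv (by simp [hR0]) (by simp [hRt]), mul_right_comm,
            ENNReal.inv_mul_cancel (by simp [hR0]) (by simp [hRt]), one_mul]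
        rw [← this]
        ring

theorem lintegral_sq_le {α : Type*} [MeasurableSpace α] {μ : Measure α} [IsProbabilityMeasure μ]
    {f : α → ℝ≥0∞} (hf : AEMeasurable f μ) : (∫⁻ a, f a ∂μ) ^ 2 ≤ ∫⁻ a, f a ^ 2 ∂μ := by
  have h := ENNReal.lintegral_mul_le_Lp_mul_Lq μ Real.HolderConjugate.two_two hf
    (aemeasurable_const (b := (1 : ℝ≥0∞)))
  simp only [Pi.mul_apply, mul_one, ENNReal.one_rpow, lintegral_const, measure_univ] at h
  have h2 := pow_le_pow_left₀ zero_le h 2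
  rw [← ENNReal.rpow_natCast (_ ^ (1 / (2 : ℝ))) 2, ← ENNReal.rpow_mul] at h2
  simpa using h2

theorem ENNReal.add_add_sq_le (a b c : ℝ≥0∞) :
    (a + b + c) ^ 2 ≤ 3 * (a ^ 2 + b ^ 2 + c ^ 2) := by
  by_cases ha : a = ∞
  · simp [ha]
  by_cases hb : b = ∞
  · simp [hb]
  by_cases hc : c = ∞
  · simp [hc]
  lift a to ℝ≥0 using ha
  lift b to ℝ≥0 using hb
  lift c to ℝ≥0 using hc
  norm_cast
  rw [← NNReal.coe_le_coe]
  push_cast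
  nlinarith [sq_nonneg ((a : ℝ) - b), sq_nonneg ((a : ℝ) - c), sq_nonneg ((b : ℝ) - c)]

theorem enorm_sub_le_lintegral_deriv {f : ℝ → ℝ} (hf : ContDiff ℝ 1 f) {a b : ℝ}
    (ha : a ∈ Set.Icc 0 1) (hb : b ∈ Set.Icc 0 1) :
    ‖f b - f a‖ₑ ≤ ∫⁻ s in Set.Ioo (0 : ℝ) 1, ‖deriv f s‖ₑ := by
  rw [← intervalIntegral.integral_deriv_eq_sub'
    f rfl (fun x _ => hf.differentiable one_ne_zero x) (hf.continuous_deriv le_rfl).continuousOn]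
  rw [← ofReal_norm, intervalIntegral.norm_intervalIntegral_eq, ofReal_norm,
    restrict_Ioo_eq_restrict_Ioc]
  refine (enorm_integral_le_lintegral_enorm _).trans (lintegral_mono_set ?_)
  rw [Set.uIoc]
  exact Set.Ioc_subset_Ioc (le_min ha.1 hb.1) (max_le ha.2 hb.2)

section PartialDerivatives

variable {E : Type*} [NormedAddCommGroup E] [InnerProductSpace ℝ E]
  {ψ : ℝ × E → ℝ}

theorem hasFDerivAt_slice (hψ : ContDiff ℝ 1 ψ) (t : ℝ) (x : E) :
    HasFDerivAt (fun y => ψ (t, y)) ((fderiv ℝ ψ (t, x)).comp (ContinuousLinearMap.inr ℝ ℝ E)) x :=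
  ((hψ.differentiable one_ne_zero (t, x)).hasFDerivAt).comp x (hasFDerivAt_prodMk_right t x)

theorem norm_gradient_slice [CompleteSpace E] (hψ : ContDiff ℝ 1 ψ) (t : ℝ) (x : E) :
    ‖gradient (fun y => ψ (t, y)) x‖ =
      ‖(fderiv ℝ ψ (t, x)).comp (ContinuousLinearMap.inr ℝ ℝ E)‖ := by
  rw [gradient, LinearIsometryEquiv.norm_map, (hasFDerivAt_slice hψ t x).fderiv]

theorem continuous_norm_gradient_slice [CompleteSpace E] (hψ : ContDiff ℝ 1 ψ) :
    Continuous fun p : ℝ × E => ‖gradient (fun y => ψ (p.1, y)) p.2‖ := by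
  simp_rw [norm_gradient_slice hψ]
  have := hψ.continuous_fderiv one_ne_zero
  fun_prop

theorem deriv_slice (hψ : ContDiff ℝ 1 ψ) (t : ℝ) (x : E) :
    deriv (fun s => ψ (s, x)) t = fderiv ℝ ψ (t, x) (1, 0) := by
  have h : HasDerivAt (fun s : ℝ => (s, x)) ((1 : ℝ), (0 : E)) t :=
    (hasDerivAt_id t).prodMk (hasDerivAt_const t x)
  exact ((hψ.differentiable one_ne_zero (t, x)).hasFDerivAt.comp_hasDerivAt t h).deriv

theorem continuous_deriv_slice (hψ : ContDiff ℝ 1 ψ) :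
    Continuous fun p : ℝ × E => deriv (fun s => ψ (s, p.2)) p.1 := by
  simp_rw [deriv_slice hψ]
  have := hψ.continuous_fderiv one_ne_zero
  fun_prop

end PartialDerivatives

section TraceEstimate

variable {n : ℕ} {ψ : ℝ × EuclideanSpace ℝ (Fin (n + 1)) → ℝ}

instance isProbabilityMeasure_restrict_Ioo :
    IsProbabilityMeasure ((volume : Measure ℝ).restrict (Set.Ioo 0 1)) :=
  ⟨by simp⟩

theorem enorm_sub_sq_le_lintegral_gradient (hψ : ContDiff ℝ 1 ψ) (t : ℝ) {r : ℝ} (hr : 0 < r)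
    {x w : EuclideanSpace ℝ (Fin (n + 1))} (hx : x ∈ sphere 0 1) (hw : w ∈ ball 0 1) :
    ‖ψ (t, (1 - r / 2) • x + (r / 2) • w) - ψ (t, x)‖ₑ ^ 2 ≤
      ∫⁻ u in Set.Ioo (0 : ℝ) 1, ENNReal.ofReal (2 * r * u) ^ 2 *
        ‖gradient (fun y => ψ (t, y)) ((1 - u ^ 2 * r / 2) • x + (u ^ 2 * r / 2) • w)‖ₑ ^ 2 := by
  let γ : ℝ → EuclideanSpace ℝ (Fin (n + 1)) := fun u =>
    (1 - u ^ 2 * r / 2) • x + (u ^ 2 * r / 2) • w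
  have hγ : ContDiff ℝ 1 γ := by fun_prop
  have hγ' (u : ℝ) : HasDerivAt γ ((u * r) • (w - x)) u := by
    have h1 : HasDerivAt (fun u : ℝ => u ^ 2 * r / 2) (u * r) u := by
      have := (((hasDerivAt_id u).pow 2).mul_const r).div_const 2
      refine this.congr_deriv ?_
      simp; ring
    refine (((h1.const_sub 1).smul_const x).add (h1.smul_const w)).congr_deriv ?_
    rw [smul_sub, neg_smul]; abel
  let f : ℝ → ℝ := fun u => ψ (t, γ u)
  have hf : ContDiff ℝ 1 f := hψ.comp (contDiff_const.prodMk hγ)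
  have hwx : ‖w - x‖ ≤ 2 := by
    rw [mem_sphere_zero_iff_norm] at hx
    rw [mem_ball_zero_iff] at hw
    linarith [norm_sub_le w x]
  have hf' (u : ℝ) (hu : u ∈ Set.Ioo (0 : ℝ) 1) :
      ‖deriv f u‖ₑ ≤ ENNReal.ofReal (2 * r * u) * ‖gradient (fun y => ψ (t, y)) (γ u)‖ₑ := by
    have h1 : deriv f u = ((fderiv ℝ ψ (t, γ u)).comp (ContinuousLinearMap.inr ℝ ℝ _))
        ((u * r) • (w - x)) :=
      ((hasFDerivAt_slice hψ t (γ u)).comp_hasDerivAt u (hγ' u)).deriv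
    rw [← ofReal_norm, ← ofReal_norm, ← ENNReal.ofReal_mul (by have := hu.1; positivity)]
    refine ENNReal.ofReal_le_ofReal ?_
    have hv : ‖(u * r) • (w - x)‖ ≤ 2 * r * u := by
      rw [norm_smul, Real.norm_of_nonneg (mul_pos hu.1 hr).le]
      nlinarith [mul_pos hu.1 hr]
    rw [h1, norm_gradient_slice hψ, mul_comm (2 * r * u)]
    exact ContinuousLinearMap.le_opNorm_of_le _ hv
  have h0 : ψ (t, (1 - r / 2) • x + (r / 2) • w) - ψ (t, x) = f 1 - f 0 := by
    simp [f, γ]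
  rw [h0]
  refine (pow_le_pow_left₀ zero_le (enorm_sub_le_lintegral_deriv hf (a := 0) (b := 1) (by simp)
    (by simp)) 2).trans ((lintegral_sq_le ?_).trans ?_)
  · exact (hf.continuous_deriv le_rfl).enorm.aemeasurable
  · refine setLIntegral_mono' measurableSet_Ioo fun u hu => ?_
    rw [← mul_pow]
    exact pow_le_pow_left₀ zero_le (hf' u hu) 2

theorem measurable_enorm_gradient_slice (hψ : ContDiff ℝ 1 ψ) :
    Measurable fun p : ℝ × EuclideanSpace ℝ (Fin (n + 1)) =>
      ‖gradient (fun y => ψ (p.1, y)) p.2‖ₑ := by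
  simp_rw [← ofReal_norm]
  exact (continuous_norm_gradient_slice hψ).measurable.ennreal_ofReal

set_option maxHeartbeats 400000 in
theorem lintegral_enorm_sub_sq_le (hψ : ContDiff ℝ 1 ψ) {K : ℝ≥0∞}
    (hK : ∀ (z : EuclideanSpace ℝ (Fin (n + 1))) (ρ : ℝ), 0 ≤ ρ →
      sphereMeasure (n + 1) (closedBall z ρ) ≤ K * ENNReal.ofReal ρ ^ n)
    (t : ℝ) {r : ℝ} (hr : 0 < r) (hr1 : r ≤ 1) :
    ∫⁻ x, ∫⁻ w, ‖ψ (t, (1 - r / 2) • x + (r / 2) • w) - ψ (t, x)‖ₑ ^ 2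
        ∂(unitBallAverage n) ∂(sphereMeasure (n + 1)) ≤
      8 * (volume (ball (0 : EuclideanSpace ℝ (Fin (n + 1))) 1))⁻¹ * (K * 2 ^ n) *
        ENNReal.ofReal r *
        ∫⁻ z in annulus n r, ‖gradient (fun y => ψ (t, y)) z‖ₑ ^ 2 := by
  have := isFiniteMeasure_sphereMeasure n
  set b := (volume (ball (0 : EuclideanSpace ℝ (Fin (n + 1))) 1))⁻¹
  let g : EuclideanSpace ℝ (Fin (n + 1)) → ℝ≥0∞ := fun z => ‖gradient (fun y => ψ (t, y)) z‖ₑ ^ 2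
  have hg : Measurable g :=
    ((measurable_enorm_gradient_slice hψ).comp (measurable_const.prodMk measurable_id)).pow_const 2
  let Φ : (EuclideanSpace ℝ (Fin (n + 1)) × EuclideanSpace ℝ (Fin (n + 1))) → ℝ → ℝ≥0∞ :=
    fun p u => ENNReal.ofReal (2 * r * u) ^ 2 *
      g ((1 - u ^ 2 * r / 2) • p.1 + (u ^ 2 * r / 2) • p.2)
  have hΦ : Measurable (Function.uncurry Φ) := by
    refine Measurable.mul (by fun_prop) (hg.comp ?_)
    fun_prop
  have hΦu (u : ℝ) : Measurable fun p => Φ p u := hΦ.comp (measurable_id.prodMk measurable_const)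
  calc _ ≤ ∫⁻ x, ∫⁻ w, (∫⁻ u in Set.Ioo (0 : ℝ) 1, Φ (x, w) u)
          ∂(unitBallAverage n) ∂(sphereMeasure (n + 1)) := by
        refine lintegral_mono_ae ?_
        filter_upwards [ae_sphereMeasure_mem_sphere (n + 1)] with x hx
        refine lintegral_mono_ae ?_
        filter_upwards [ae_unitBallAverage_mem_ball n] with w hw
        exact enorm_sub_sq_le_lintegral_gradient hψ t hr hx hw
    _ = ∫⁻ p, (∫⁻ u in Set.Ioo (0 : ℝ) 1, Φ p u)
          ∂((sphereMeasure (n + 1)).prod (unitBallAverage n)) :=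
        (lintegral_prod _ hΦ.lintegral_prod_right'.aemeasurable).symm
    _ = ∫⁻ u in Set.Ioo (0 : ℝ) 1, ∫⁻ p, Φ p u
          ∂((sphereMeasure (n + 1)).prod (unitBallAverage n)) :=
        lintegral_lintegral_swap hΦ.aemeasurable
    _ ≤ ∫⁻ u in Set.Ioo (0 : ℝ) 1, 8 * b * (K * 2 ^ n) * ENNReal.ofReal r *
          ∫⁻ z in annulus n r, g z := by
        refine setLIntegral_mono' measurableSet_Ioo fun u hu => ?_
        have hu0 : 0 < u := hu.1
        have hρ : 0 < u ^ 2 * r / 2 := by positivity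
        have hρr : 2 * (u ^ 2 * r / 2) ≤ r := by nlinarith [hu.2, mul_pos hu0 hr]
        rw [lintegral_prod _ (hΦu u).aemeasurable]
        have hmeas : Measurable fun p : EuclideanSpace ℝ (Fin (n + 1)) × EuclideanSpace ℝ
            (Fin (n + 1)) => g ((1 - u ^ 2 * r / 2) • p.1 + (u ^ 2 * r / 2) • p.2) :=
          hg.comp (by fun_prop)
        have h1 (x : EuclideanSpace ℝ (Fin (n + 1))) : ∫⁻ w, Φ (x, w) u ∂(unitBallAverage n) =
            ENNReal.ofReal (2 * r * u) ^ 2 *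
              ∫⁻ w, g ((1 - u ^ 2 * r / 2) • x + (u ^ 2 * r / 2) • w) ∂(unitBallAverage n) :=
          lintegral_const_mul _ (hmeas.comp (measurable_const.prodMk measurable_id))
        simp_rw [h1]
        rw [lintegral_const_mul _ hmeas.lintegral_prod_right']
        refine (mul_le_mul' le_rfl
          (lintegral_sphereMeasure_unitBallAverage_le hK hρ hρr hr1 hg)).trans_eq ?_
        have h2 : ENNReal.ofReal (2 * r * u) ^ 2 * (ENNReal.ofReal (u ^ 2 * r / 2))⁻¹ =
            8 * ENNReal.ofReal r := by
          rw [← ENNReal.ofReal_inv_of_pos hρ, ← ENNReal.ofReal_pow (by positivity),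
            ← ENNReal.ofReal_mul (by positivity), ← ENNReal.ofReal_ofNat 8,
            ← ENNReal.ofReal_mul (by positivity)]
          congr 1
          field_simp
          norm_num
        calc _ = (ENNReal.ofReal (2 * r * u) ^ 2 * (ENNReal.ofReal (u ^ 2 * r / 2))⁻¹) *
              (b * (K * 2 ^ n)) * ∫⁻ z in annulus n r, g z := by ring
          _ = _ := by rw [h2]; ring
    _ = _ := by rw [lintegral_const, measure_univ, mul_one]

/-- Pointwise bound of the deviation from the time average. -/
theorem enorm_sub_average_sq_le (hψ : ContDiff ℝ 1 ψ) {t : ℝ} (ht : t ∈ Set.Ioo (0 : ℝ) 1) (r : ℝ)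
    (x : EuclideanSpace ℝ (Fin (n + 1))) :
    ‖ψ (t, x) - ∫ s in Set.Ioo (0 : ℝ) 1, ψ (s, x)‖ₑ ^ 2 ≤
      3 * (∫⁻ w, ‖ψ (t, (1 - r / 2) • x + (r / 2) • w) - ψ (t, x)‖ₑ ^ 2 ∂(unitBallAverage n) +
        (∫⁻ s in Set.Ioo (0 : ℝ) 1, ∫⁻ w, ‖ψ (s, (1 - r / 2) • x + (r / 2) • w) - ψ (s, x)‖ₑ ^ 2
          ∂(unitBallAverage n)) +
        (∫⁻ w, (∫⁻ s in Set.Ioo (0 : ℝ) 1,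
          ‖deriv (fun s => ψ (s, (1 - r / 2) • x + (r / 2) • w)) s‖ₑ) ∂(unitBallAverage n)) ^ 2) := by
  have hc := hψ.continuous
  let y : EuclideanSpace ℝ (Fin (n + 1)) → EuclideanSpace ℝ (Fin (n + 1)) :=
    fun w => (1 - r / 2) • x + (r / 2) • w
  have hy : Continuous y := by fun_prop
  let D : ℝ → EuclideanSpace ℝ (Fin (n + 1)) → ℝ≥0∞ := fun s w => ‖ψ (s, y w) - ψ (s, x)‖ₑ
  let h : EuclideanSpace ℝ (Fin (n + 1)) → ℝ≥0∞ := fun w =>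
    ∫⁻ s in Set.Ioo (0 : ℝ) 1, ‖deriv (fun s => ψ (s, y w)) s‖ₑ
  have hD : Measurable (Function.uncurry D) := by
    have : Continuous (Function.uncurry D) := by
      simp only [D, Function.uncurry_def]
      fun_prop
    exact this.measurable
  have hDs (s : ℝ) : Measurable (D s) := hD.comp (measurable_const.prodMk measurable_id)
  have hh : Measurable h := by
    have : Measurable fun p : EuclideanSpace ℝ (Fin (n + 1)) × ℝ =>
        ‖deriv (fun s => ψ (s, y p.1)) p.2‖ₑ :=
      ((continuous_deriv_slice hψ).comp (continuous_snd.prodMk (hy.comp continuous_fst))).enorm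
        |>.measurable
    exact this.lintegral_prod_right'
  have hint : IntegrableOn (fun s => ψ (s, x)) (Set.Ioo 0 1) :=
    ((by fun_prop : Continuous fun s => ψ (s, x)).continuousOn.integrableOn_compact
      isCompact_Icc).mono_set Set.Ioo_subset_Icc_self
  have hpt (s : ℝ) (hs : s ∈ Set.Ioo (0 : ℝ) 1) (w) :
      ‖ψ (t, x) - ψ (s, x)‖ₑ ≤ D t w + D s w + h w := by
    have h1 : ψ (t, x) - ψ (s, x) =
        -(ψ (t, y w) - ψ (t, x)) + (ψ (s, y w) - ψ (s, x)) + (ψ (t, y w) - ψ (s, y w)) := by ring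
    rw [h1]
    refine (enorm_add_le _ _).trans (add_le_add ((enorm_add_le _ _).trans ?_) ?_)
    · rw [enorm_neg]
    · exact enorm_sub_le_lintegral_deriv (f := fun s => ψ (s, y w))
        (hψ.comp (contDiff_id.prodMk contDiff_const)) (Set.Ioo_subset_Icc_self hs)
        (Set.Ioo_subset_Icc_self ht)
  have hpt' (s : ℝ) (hs : s ∈ Set.Ioo (0 : ℝ) 1) :
      ‖ψ (t, x) - ψ (s, x)‖ₑ ≤ ∫⁻ w, D t w ∂(unitBallAverage n) +
        ∫⁻ w, D s w ∂(unitBallAverage n) + ∫⁻ w, h w ∂(unitBallAverage n) := by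
    rw [← lintegral_add_left (hDs t), ← lintegral_add_right _ hh]
    calc _ = ∫⁻ w, ‖ψ (t, x) - ψ (s, x)‖ₑ ∂(unitBallAverage n) := by simp
      _ ≤ _ := lintegral_mono (hpt s hs)
  have hbound : ‖ψ (t, x) - ∫ s in Set.Ioo (0 : ℝ) 1, ψ (s, x)‖ₑ ≤
      ∫⁻ w, D t w ∂(unitBallAverage n) +
        (∫⁻ s in Set.Ioo (0 : ℝ) 1, ∫⁻ w, D s w ∂(unitBallAverage n)) +
        ∫⁻ w, h w ∂(unitBallAverage n) := by
    have h1 : ψ (t, x) - ∫ s in Set.Ioo (0 : ℝ) 1, ψ (s, x) =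
        ∫ s in Set.Ioo (0 : ℝ) 1, (ψ (t, x) - ψ (s, x)) := by
      rw [integral_sub (integrable_const _) hint]; simp
    rw [h1]
    refine (enorm_integral_le_lintegral_enorm _).trans ?_
    refine (setLIntegral_mono' measurableSet_Ioo hpt').trans_eq ?_
    rw [lintegral_add_right _ measurable_const, lintegral_add_left measurable_const]
    simp
  refine (pow_le_pow_left₀ zero_le hbound 2).trans ((ENNReal.add_add_sq_le _ _ _).trans ?_)
  gcongr
  · exact lintegral_sq_le (hDs t).aemeasurable
  · refine (lintegral_sq_le hD.lintegral_prod_right'.aemeasurable).trans ?_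
    exact lintegral_mono fun s => lintegral_sq_le (hDs s).aemeasurable

theorem measurable_enorm_deriv_slice (hψ : ContDiff ℝ 1 ψ) :
    Measurable fun p : EuclideanSpace ℝ (Fin (n + 1)) × ℝ => ‖deriv (fun s => ψ (s, p.1)) p.2‖ₑ :=
  ((continuous_deriv_slice hψ).comp continuous_swap).enorm.measurable

theorem lintegral_sq_average_deriv_le (hψ : ContDiff ℝ 1 ψ) {K : ℝ≥0∞}
    (hK : ∀ (z : EuclideanSpace ℝ (Fin (n + 1))) (ρ : ℝ), 0 ≤ ρ →
      sphereMeasure (n + 1) (closedBall z ρ) ≤ K * ENNReal.ofReal ρ ^ n)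
    {r : ℝ} (hr : 0 < r) (hr1 : r ≤ 1) :
    ∫⁻ x, (∫⁻ w, (∫⁻ s in Set.Ioo (0 : ℝ) 1,
        ‖deriv (fun s => ψ (s, (1 - r / 2) • x + (r / 2) • w)) s‖ₑ) ∂(unitBallAverage n)) ^ 2
          ∂(sphereMeasure (n + 1)) ≤
      (volume (ball (0 : EuclideanSpace ℝ (Fin (n + 1))) 1))⁻¹ ^ 2 * (K * 2 ^ n) * 2 ^ (n + 2) *
        (ENNReal.ofReal r ^ (n + 2))⁻¹ *
        (∫⁻ t in Set.Ioo (0 : ℝ) 1, ∫⁻ z in annulus n r, ‖deriv (fun s => ψ (s, z)) t‖ₑ) ^ 2 := by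
  have := isFiniteMeasure_sphereMeasure n
  set b := (volume (ball (0 : EuclideanSpace ℝ (Fin (n + 1))) 1))⁻¹
  set R := ENNReal.ofReal r
  let h : EuclideanSpace ℝ (Fin (n + 1)) → ℝ≥0∞ := fun z =>
    ∫⁻ s in Set.Ioo (0 : ℝ) 1, ‖deriv (fun s => ψ (s, z)) s‖ₑ
  have hh : Measurable h := (measurable_enorm_deriv_slice hψ).lintegral_prod_right'
  let H : EuclideanSpace ℝ (Fin (n + 1)) → ℝ≥0∞ := fun x =>
    ∫⁻ w, h ((1 - r / 2) • x + (r / 2) • w) ∂(unitBallAverage n)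
  have hH : Measurable H := by
    have : Measurable fun p : EuclideanSpace ℝ (Fin (n + 1)) × EuclideanSpace ℝ (Fin (n + 1)) =>
        h ((1 - r / 2) • p.1 + (r / 2) • p.2) := hh.comp (by fun_prop)
    exact this.lintegral_prod_right'
  have hM : ∫⁻ t in Set.Ioo (0 : ℝ) 1, ∫⁻ z in annulus n r, ‖deriv (fun s => ψ (s, z)) t‖ₑ =
      ∫⁻ z in annulus n r, h z :=
    (lintegral_lintegral_swap (f := fun z t => ‖deriv (fun s => ψ (s, z)) t‖ₑ)
      (measurable_enorm_deriv_slice hψ).aemeasurable).symm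
  rw [hM]
  set M := ∫⁻ z in annulus n r, h z
  have hR : (ENNReal.ofReal (r / 2))⁻¹ = 2 * R⁻¹ := by
    rw [ENNReal.ofReal_div_of_pos (by norm_num), ENNReal.inv_div (by simp) (by simp)]
    simp [R, div_eq_mul_inv]
  have hρ : 0 < r / 2 := by positivity
  have hρr : 2 * (r / 2) ≤ r := by linarith
  calc ∫⁻ x, H x ^ 2 ∂(sphereMeasure (n + 1))
      ≤ ∫⁻ x, b * (ENNReal.ofReal (r / 2) ^ (n + 1))⁻¹ * M * H x ∂(sphereMeasure (n + 1)) := by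
        refine lintegral_mono_ae ?_
        filter_upwards [ae_sphereMeasure_mem_sphere (n + 1)] with x hx
        rw [pow_two]
        exact mul_le_mul' (lintegral_unitBallAverage_le hx hρ hρr hr1 hh) le_rfl
    _ = b * (ENNReal.ofReal (r / 2) ^ (n + 1))⁻¹ * M * ∫⁻ x, H x ∂(sphereMeasure (n + 1)) :=
        lintegral_const_mul _ hH
    _ ≤ b * (ENNReal.ofReal (r / 2) ^ (n + 1))⁻¹ * M *
          (b * (K * 2 ^ n) * (ENNReal.ofReal (r / 2))⁻¹ * M) :=
        mul_le_mul' le_rfl (lintegral_sphereMeasure_unitBallAverage_le hK hρ hρr hr1 hh)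
    _ = _ := by
        clear_value b
        rw [ENNReal.inv_pow, ENNReal.inv_pow, hR]
        ring

/-- The squared trace estimate, for integrals with values in `[0, ∞]`. -/
theorem lintegral_sub_average_sq_le (hψ : ContDiff ℝ 1 ψ) {K : ℝ≥0∞}
    (hK : ∀ (z : EuclideanSpace ℝ (Fin (n + 1))) (ρ : ℝ), 0 ≤ ρ →
      sphereMeasure (n + 1) (closedBall z ρ) ≤ K * ENNReal.ofReal ρ ^ n)
    {r : ℝ} (hr : 0 < r) (hr1 : r ≤ 1) :
    ∫⁻ t in Set.Ioo (0 : ℝ) 1, ∫⁻ x, ‖ψ (t, x) - ∫ s in Set.Ioo (0 : ℝ) 1, ψ (s, x)‖ₑ ^ 2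
        ∂(sphereMeasure (n + 1)) ≤
      48 * (volume (ball (0 : EuclideanSpace ℝ (Fin (n + 1))) 1))⁻¹ * (K * 2 ^ n) *
        ENNReal.ofReal r * (∫⁻ t in Set.Ioo (0 : ℝ) 1, ∫⁻ z in annulus n r,
          ‖gradient (fun y => ψ (t, y)) z‖ₑ ^ 2) +
      3 * (volume (ball (0 : EuclideanSpace ℝ (Fin (n + 1))) 1))⁻¹ ^ 2 * (K * 2 ^ n) *
        2 ^ (n + 2) * (ENNReal.ofReal r ^ (n + 2))⁻¹ *
        (∫⁻ t in Set.Ioo (0 : ℝ) 1, ∫⁻ z in annulus n r, ‖deriv (fun s => ψ (s, z)) t‖ₑ) ^ 2 := by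
  have := isFiniteMeasure_sphereMeasure n
  set b := (volume (ball (0 : EuclideanSpace ℝ (Fin (n + 1))) 1))⁻¹
  set R := ENNReal.ofReal r
  let Q : ℝ → EuclideanSpace ℝ (Fin (n + 1)) → ℝ≥0∞ := fun t x =>
    ∫⁻ w, ‖ψ (t, (1 - r / 2) • x + (r / 2) • w) - ψ (t, x)‖ₑ ^ 2 ∂(unitBallAverage n)
  let H : EuclideanSpace ℝ (Fin (n + 1)) → ℝ≥0∞ := fun x =>
    ∫⁻ w, (∫⁻ s in Set.Ioo (0 : ℝ) 1,
      ‖deriv (fun s => ψ (s, (1 - r / 2) • x + (r / 2) • w)) s‖ₑ) ∂(unitBallAverage n)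
  have hQ : Measurable (Function.uncurry Q) := by
    have : Measurable fun p : (ℝ × EuclideanSpace ℝ (Fin (n + 1))) ×
        EuclideanSpace ℝ (Fin (n + 1)) =>
        ‖ψ (p.1.1, (1 - r / 2) • p.1.2 + (r / 2) • p.2) - ψ (p.1.1, p.1.2)‖ₑ ^ 2 := by
      refine Measurable.pow_const (Continuous.measurable ?_) 2
      fun_prop
    exact this.lintegral_prod_right'
  have hQt (t : ℝ) : Measurable (Q t) := hQ.comp (measurable_const.prodMk measurable_id)
  have hQs : Measurable fun x => ∫⁻ s in Set.Ioo (0 : ℝ) 1, Q s x := hQ.lintegral_prod_left'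
  set I := ∫⁻ t in Set.Ioo (0 : ℝ) 1, ∫⁻ z in annulus n r,
    ‖gradient (fun y => ψ (t, y)) z‖ₑ ^ 2
  have hmain : ∫⁻ t in Set.Ioo (0 : ℝ) 1, ∫⁻ x, Q t x ∂(sphereMeasure (n + 1)) ≤
      8 * b * (K * 2 ^ n) * R * I := by
    refine (lintegral_mono fun t => lintegral_enorm_sub_sq_le hψ hK t hr hr1).trans_eq ?_
    refine lintegral_const_mul _ ?_
    exact ((measurable_enorm_gradient_slice hψ).pow_const 2).lintegral_prod_right'
  have hswap : ∫⁻ x, (∫⁻ s in Set.Ioo (0 : ℝ) 1, Q s x) ∂(sphereMeasure (n + 1)) =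
      ∫⁻ t in Set.Ioo (0 : ℝ) 1, ∫⁻ x, Q t x ∂(sphereMeasure (n + 1)) :=
    (lintegral_lintegral_swap hQ.aemeasurable).symm
  calc _ ≤ ∫⁻ t in Set.Ioo (0 : ℝ) 1, ∫⁻ x, 3 * (Q t x + (∫⁻ s in Set.Ioo (0 : ℝ) 1, Q s x) +
          H x ^ 2) ∂(sphereMeasure (n + 1)) :=
        setLIntegral_mono' measurableSet_Ioo fun t ht =>
          lintegral_mono fun x => enorm_sub_average_sq_le hψ ht r x
    _ = ∫⁻ t in Set.Ioo (0 : ℝ) 1, 3 * (∫⁻ x, Q t x ∂(sphereMeasure (n + 1)) +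
          (∫⁻ x, (∫⁻ s in Set.Ioo (0 : ℝ) 1, Q s x) ∂(sphereMeasure (n + 1)) +
          ∫⁻ x, H x ^ 2 ∂(sphereMeasure (n + 1)))) := by
        refine lintegral_congr fun t => ?_
        rw [lintegral_const_mul' _ _ (by norm_num)]
        simp_rw [add_assoc]
        rw [lintegral_add_left (hQt t), lintegral_add_left hQs]
    _ = 3 * ((∫⁻ t in Set.Ioo (0 : ℝ) 1, ∫⁻ x, Q t x ∂(sphereMeasure (n + 1))) +
          ((∫⁻ t in Set.Ioo (0 : ℝ) 1, ∫⁻ x, Q t x ∂(sphereMeasure (n + 1))) +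
          ∫⁻ x, H x ^ 2 ∂(sphereMeasure (n + 1)))) := by
        rw [lintegral_const_mul' _ _ (by norm_num), lintegral_add_right _ measurable_const,
          lintegral_const, measure_univ, mul_one, hswap]
    _ ≤ 3 * (8 * b * (K * 2 ^ n) * R * I + (8 * b * (K * 2 ^ n) * R * I +
          b ^ 2 * (K * 2 ^ n) * 2 ^ (n + 2) * (R ^ (n + 2))⁻¹ *
            (∫⁻ t in Set.Ioo (0 : ℝ) 1, ∫⁻ z in annulus n r,
              ‖deriv (fun s => ψ (s, z)) t‖ₑ) ^ 2)) :=
        mul_le_mul' le_rfl (add_le_add hmain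
          (add_le_add hmain (lintegral_sq_average_deriv_le hψ hK hr hr1)))
    _ = _ := by ring

theorem ofReal_integral_annulus {f : ℝ × EuclideanSpace ℝ (Fin (n + 1)) → ℝ} (hf : Continuous f)
    (hf0 : ∀ p, 0 ≤ f p) (r : ℝ) :
    ENNReal.ofReal (∫ t in Set.Ioo (0 : ℝ) 1, ∫ x in annulus n r, f (t, x)) =
      ∫⁻ t in Set.Ioo (0 : ℝ) 1, ∫⁻ x in annulus n r, ENNReal.ofReal (f (t, x)) := by
  have hint : Integrable f ((volume.restrict (Set.Ioo 0 1)).prod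
      (volume.restrict (annulus n r))) := by
    rw [Measure.prod_restrict]
    exact (hf.continuousOn.integrableOn_compact
      ((isCompact_Icc (a := (0 : ℝ)) (b := 1)).prod (isCompact_closedBall 0 1))).mono_set
      (Set.prod_mono Set.Ioo_subset_Icc_self (Set.sdiff_subset.trans ball_subset_closedBall))
  rw [← integral_prod f hint, ofReal_integral_eq_lintegral_ofReal hint (.of_forall hf0),
    lintegral_prod _ hf.measurable.ennreal_ofReal.aemeasurable]

end TraceEstimate

theorem ofReal_integral_integral_sq_le {α β : Type*} [MeasurableSpace α] [MeasurableSpace β]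
    (μ : Measure α) (ν : Measure β) (F : α → β → ℝ) :
    ENNReal.ofReal (∫ t, ∫ x, F t x ^ 2 ∂ν ∂μ) ≤ ∫⁻ t, ∫⁻ x, ‖F t x‖ₑ ^ 2 ∂ν ∂μ := by
  rw [← Real.enorm_of_nonneg (integral_nonneg fun t => integral_nonneg fun x => sq_nonneg _)]
  refine (enorm_integral_le_lintegral_enorm _).trans (lintegral_mono fun t => ?_)
  refine (enorm_integral_le_lintegral_enorm _).trans_eq ?_
  simp [enorm_pow]

theorem sqrt_le_of_le_add {c₁ c₂ r I J X : ℝ} (m : ℕ) (hc₁ : 0 ≤ c₁) (hc₂ : 0 ≤ c₂) (hr : 0 < r)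
    (hI : 0 ≤ I) (hJ : 0 ≤ J) (hX : X ≤ c₁ * r * I + c₂ * (r ^ m)⁻¹ * J ^ 2) :
    √X ≤ (√c₁ + √c₂ + 1) * (√r * √I + r ^ (-(m : ℝ) / 2) * J) := by
  have hexp : (r ^ (-(m : ℝ) / 2)) ^ 2 = (r ^ m)⁻¹ := by
    rw [← Real.rpow_natCast, ← Real.rpow_mul hr.le, ← Real.rpow_natCast, ← Real.rpow_neg hr.le]
    congr 1
    push_cast
    ring
  have hE : 0 ≤ r ^ (-(m : ℝ) / 2) := Real.rpow_nonneg hr.le _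
  set e := r ^ (-(m : ℝ) / 2)
  have h1 : 0 ≤ √r * √I := by positivity
  have h2 : 0 ≤ e * J := by positivity
  have h3 : √X ≤ √c₁ * (√r * √I) + √c₂ * (e * J) := by
    refine Real.sqrt_le_iff.2 ⟨by positivity, hX.trans ?_⟩
    have h4 : (√c₁ * (√r * √I)) ^ 2 = c₁ * r * I := by
      rw [mul_pow, mul_pow, Real.sq_sqrt hc₁, Real.sq_sqrt hr.le, Real.sq_sqrt hI, mul_assoc]
    have h5 : (√c₂ * (e * J)) ^ 2 = c₂ * (r ^ m)⁻¹ * J ^ 2 := by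
      rw [mul_pow, mul_pow, Real.sq_sqrt hc₂, hexp, mul_assoc]
    have h6 : 0 ≤ √c₁ * (√r * √I) * (√c₂ * (e * J)) := by positivity
    nlinarith
  have h7 := Real.sqrt_nonneg c₁
  have h8 := Real.sqrt_nonneg c₂
  nlinarith [mul_nonneg h7 h2, mul_nonneg h8 h1]

/-- Space-time trace estimate on the boundary annulus `A_r = B₁ \ B_{1−r}`:
`(∫₀¹∫_{∂B₁}(ψ−ψ̄)²)^{1/2} ≤ C(d)[ r^{1/2}(∫₀¹∫_{A_r}|∇ψ|²)^{1/2}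
  + r^{−(d+1)/2} ∫₀¹∫_{A_r}|∂_t ψ| ]`, where `ψ̄(x) = ∫₀¹ ψ(t,x) dt`. -/
theorem stmt7 (d : ℕ) (hd : 1 ≤ d) :
    ∃ C : ℝ, 0 < C ∧
      ∀ (ψ : ℝ × EuclideanSpace ℝ (Fin d) → ℝ) (r : ℝ), 0 < r → r ≤ 1 →
        ContDiff ℝ 1 ψ →
        Real.sqrt (∫ t in Set.Ioo (0:ℝ) 1, ∫ x,
            (ψ (t, x) - ∫ s in Set.Ioo (0:ℝ) 1, ψ (s, x)) ^ 2 ∂(sphereMeasure d)) ≤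
          C * (Real.sqrt r *
              Real.sqrt (∫ t in Set.Ioo (0:ℝ) 1,
                ∫ x in Metric.ball (0 : EuclideanSpace ℝ (Fin d)) 1 \
                    Metric.ball (0 : EuclideanSpace ℝ (Fin d)) (1 - r),
                  ‖gradient (fun y => ψ (t, y)) x‖ ^ 2) +
            r ^ (-((d : ℝ) + 1) / 2) *
              ∫ t in Set.Ioo (0:ℝ) 1,
                ∫ x in Metric.ball (0 : EuclideanSpace ℝ (Fin d)) 1 \
                    Metric.ball (0 : EuclideanSpace ℝ (Fin d)) (1 - r),
                  |deriv (fun s => ψ (s, x)) t|) := by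
  obtain ⟨n, rfl⟩ : ∃ n, d = n + 1 := ⟨d - 1, by omega⟩
  obtain ⟨K, hKt, hK⟩ := exists_sphereMeasure_closedBall_le n
  set b := (volume (ball (0 : EuclideanSpace ℝ (Fin (n + 1))) 1))⁻¹ with hb
  have hbt : b ≠ ∞ := ENNReal.inv_ne_top.2 (volume_unitBall_ne_zero n)
  obtain ⟨c₁, hc₁⟩ : ∃ c : ℝ≥0, (c : ℝ≥0∞) = 48 * b * (K * 2 ^ n) :=
    ENNReal.canLift.prf _ (by finiteness)
  obtain ⟨c₂, hc₂⟩ : ∃ c : ℝ≥0, (c : ℝ≥0∞) = 3 * b ^ 2 * (K * 2 ^ n) * 2 ^ (n + 2) :=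
    ENNReal.canLift.prf _ (by finiteness)
  refine ⟨√c₁ + √c₂ + 1, by positivity, fun ψ r hr hr1 hψ => ?_⟩
  have hm : -(((n + 1 : ℕ) : ℝ) + 1) / 2 = -((n + 2 : ℕ) : ℝ) / 2 := by push_cast; ring
  rw [hm]
  refine sqrt_le_of_le_add (n + 2) c₁.2 c₂.2 hr ?_ ?_ ?_
  · exact integral_nonneg fun t => integral_nonneg fun x => sq_nonneg _
  · exact integral_nonneg fun t => integral_nonneg fun x => abs_nonneg _
  have hI : ENNReal.ofReal (∫ t in Set.Ioo (0 : ℝ) 1, ∫ x in annulus n r,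
      ‖gradient (fun y => ψ (t, y)) x‖ ^ 2) = ∫⁻ t in Set.Ioo (0 : ℝ) 1, ∫⁻ x in annulus n r,
      ‖gradient (fun y => ψ (t, y)) x‖ₑ ^ 2 := by
    refine (ofReal_integral_annulus ((continuous_norm_gradient_slice hψ).pow 2)
      (fun p => sq_nonneg _) r).trans ?_
    simp [ENNReal.ofReal_pow, ofReal_norm]
  have hJ : ENNReal.ofReal (∫ t in Set.Ioo (0 : ℝ) 1, ∫ x in annulus n r,
      |deriv (fun s => ψ (s, x)) t|) = ∫⁻ t in Set.Ioo (0 : ℝ) 1, ∫⁻ x in annulus n r,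
      ‖deriv (fun s => ψ (s, x)) t‖ₑ := by
    simp_rw [Real.enorm_eq_ofReal_abs]
    exact ofReal_integral_annulus (continuous_deriv_slice hψ).abs
      (fun p => abs_nonneg _) r
  have hI0 : 0 ≤ ∫ t in Set.Ioo (0 : ℝ) 1, ∫ x in annulus n r,
      ‖gradient (fun y => ψ (t, y)) x‖ ^ 2 :=
    integral_nonneg fun t => integral_nonneg fun x => sq_nonneg _
  have hJ0 : 0 ≤ ∫ t in Set.Ioo (0 : ℝ) 1, ∫ x in annulus n r, |deriv (fun s => ψ (s, x)) t| :=
    integral_nonneg fun t => integral_nonneg fun x => abs_nonneg _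
  have key := (ofReal_integral_integral_sq_le (volume.restrict (Set.Ioo (0 : ℝ) 1))
    (sphereMeasure (n + 1)) _).trans (lintegral_sub_average_sq_le hψ hK hr hr1)
  rw [← hb, ← hc₁, ← hc₂, ← hI, ← hJ, ← ENNReal.ofReal_coe_nnreal, ← ENNReal.ofReal_coe_nnreal,
    ← ENNReal.ofReal_pow hr.le, ← ENNReal.ofReal_inv_of_pos (by positivity),
    ← ENNReal.ofReal_pow hJ0, ← ENNReal.ofReal_mul (by positivity),
    ← ENNReal.ofReal_mul (by positivity), ← ENNReal.ofReal_mul (by positivity),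
    ← ENNReal.ofReal_mul (by positivity), ← ENNReal.ofReal_add (by positivity) (by positivity),
    ENNReal.ofReal_le_ofReal_iff (by positivity)] at key
  exact key
end
end

section
/- Localized McCann displacement convexity: assume ρ₀(0) = ρ₁(0) = 1, and that the transport energy ∫_{B₁}|T−x|²ρ₀ and the Hölder seminorms [ρ₀]_{α,1}, [ρ₁]_{α,1} are sufficiently small. Then for every t ∈ [0,1], the interpolated density ρ(t,·) := (T_t)_# ρ₀, with T_t(x) = tT(x)+(1−t)x, satisfies sup_{B_{1/2}} ρ(t,·) ≤ 1 + [ρ₀]_{α,1} + [ρ₁]_{α,1}. -/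
open MeasureTheory Metric

noncomputable section

section

variable {E : Type*} [NormedAddCommGroup E] [InnerProductSpace ℝ E] {T : E → E} {ψ : E → ℝ}

theorem norm_le_of_sq_le_inner {u v : E} (h : ‖u‖ ^ 2 ≤ inner ℝ u v) : ‖u‖ ≤ ‖v‖ := by
  rcases (norm_nonneg u).eq_or_lt with h0 | h0
  · rw [← h0]; positivity
  · exact le_of_mul_le_mul_left ((sq ‖u‖).symm.trans_le (h.trans (real_inner_le_norm u v))) h0

theorem norm_fderiv_sq_le_inner {J : E → E} {S : E →L[ℝ] E} {z : E}
    (hJ : ∀ z w, ‖J z - J w‖ ^ 2 ≤ inner ℝ (J z - J w) (z - w)) (hS : HasFDerivAt J S z) (v : E) :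
    ‖S v‖ ^ 2 ≤ inner ℝ (S v) v := by
  have hlim := (hS.hasLineDerivAt v).tendsto_slope_zero
  refine le_of_tendsto_of_tendsto (hlim.norm.pow 2) (hlim.inner tendsto_const_nhds) ?_
  filter_upwards [self_mem_nhdsWithin] with s hs
  have h := hJ (z + s • v) z
  rw [add_sub_cancel_left, inner_smul_right] at h
  rw [norm_smul, inner_smul_left, mul_pow, norm_inv, inv_pow, Real.norm_eq_abs, sq_abs]
  have hs2 : 0 < s ^ 2 := by have : s ≠ 0 := hs; positivity
  rw [inv_mul_le_iff₀ hs2]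
  refine h.trans_eq ?_
  have : s ≠ 0 := hs
  simp only [conj_trivial]
  field_simp

/-- A large displacement of a monotone map at one point propagates to a whole nearby ball. -/
theorem exists_ball_le_norm_sub_of_monotone (hmono : ∀ x y, 0 ≤ inner ℝ (T x - T y) (x - y))
    {x : E} (hx : 1 / 8 < ‖T x - x‖) :
    ∃ c, ball c (1 / 128) ⊆ ball x (1 / 16) ∧ ∀ y ∈ ball c (1 / 128), 1 / 32 ≤ ‖T y - y‖ := by
  set u := T x - x with hu
  have hu0 : ‖u‖ ≠ 0 := by linarith
  set e := ‖u‖⁻¹ • u with he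
  have hnorm : ‖e‖ = 1 := by rw [he, norm_smul, norm_inv, norm_norm, inv_mul_cancel₀ hu0]
  have hue : inner ℝ u e = ‖u‖ := by
    rw [he, inner_smul_right, real_inner_self_eq_norm_sq]; field_simp
  have hc : ∀ y ∈ ball (x + (1 / 32 : ℝ) • e) (1 / 128), ∃ w : E, ‖w‖ ≤ 1 / 128 ∧
      y - x = (1 / 32 : ℝ) • e + w ∧ ‖y - x‖ ≤ 5 / 128 := fun y hy => by
    rw [mem_ball_iff_norm] at hy
    have h : y - x = (1 / 32 : ℝ) • e + (y - (x + (1 / 32 : ℝ) • e)) := by abel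
    refine ⟨_, hy.le, h, ?_⟩
    rw [h]
    refine (norm_add_le _ _).trans ?_
    rw [norm_smul, hnorm, Real.norm_of_nonneg (by norm_num)]
    linarith
  refine ⟨x + (1 / 32 : ℝ) • e, fun y hy => ?_, fun y hy => ?_⟩
  · obtain ⟨w, -, -, h⟩ := hc y hy
    rw [mem_ball_iff_norm]
    linarith
  · obtain ⟨w, hw, hyx, hyn⟩ := hc y hy
    by_contra! hlt
    have h1 := hmono y x
    have h2 : T y - T x = (T y - y) - u + (y - x) := by rw [hu]; abel
    rw [h2, inner_add_left, inner_sub_left, real_inner_self_eq_norm_sq] at h1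
    have h3 : inner ℝ u (y - x) = 1 / 32 * ‖u‖ + inner ℝ u w := by
      rw [hyx, inner_add_right, inner_smul_right, hue]
    have h4 := (abs_le.1 (abs_real_inner_le_norm u w)).1
    have h5 : ‖u‖ * ‖w‖ ≤ ‖u‖ * (1 / 128) := by gcongr
    have h6 : inner ℝ (T y - y) (y - x) ≤ 1 / 32 * (5 / 128) :=
      (real_inner_le_norm _ _).trans (by gcongr)
    have h7 : ‖y - x‖ ^ 2 ≤ (5 / 128) ^ 2 := by gcongr
    linarith

/-- If a monotone map is close to the identity on a ball, then the preimage of a smaller ball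
under its displacement interpolant stays inside that ball. -/
theorem norm_lt_of_interpolant_mem_ball (hmono : ∀ x y, 0 ≤ inner ℝ (T x - T y) (x - y))
    (hT : ∀ x, ‖x‖ ≤ 3 / 4 → ‖T x - x‖ ≤ 1 / 8) {t : ℝ} (ht : t ∈ Set.Icc (0 : ℝ) 1) {x : E}
    (hx : ‖t • T x + (1 - t) • x‖ < 1 / 2) : ‖x‖ < 3 / 4 := by
  by_contra! hge
  have hx0 : 0 < ‖x‖ := by linarith
  set s : ℝ := 3 / 4 / ‖x‖ with hs
  have hs1 : s ≤ 1 := (div_le_one hx0).2 hge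
  have hsx : s * ‖x‖ = 3 / 4 := by rw [hs]; field_simp
  set y := s • x with hy
  have hyn : ‖y‖ = 3 / 4 := by
    rw [hy, norm_smul, Real.norm_of_nonneg (by positivity), hsx]
  have hTy : -(1 / 8 * ‖x‖) ≤ inner ℝ (T y - y) x :=
    (neg_le_neg (by gcongr; exact hT y hyn.le)).trans
      (abs_le.1 (abs_real_inner_le_norm (T y - y) x)).1
  have hyx : inner ℝ y x = 3 / 4 * ‖x‖ := by
    rw [hy, inner_smul_left, real_inner_self_eq_norm_sq, conj_trivial, ← hsx]; ring
  have hle : inner ℝ (T y) x ≤ inner ℝ (T x) x := by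
    rcases hs1.eq_or_lt with h | h
    · rw [hy, h, one_smul]
    · have h1 := hmono x y
      have h2 : x - y = (1 - s) • x := by rw [hy]; module
      rw [h2, inner_smul_right] at h1
      have h3 := nonneg_of_mul_nonneg_right h1 (sub_pos.2 h)
      rw [inner_sub_left] at h3
      linarith
  have hup := (real_inner_le_norm (t • T x + (1 - t) • x) x).trans
    (mul_le_mul_of_nonneg_right hx.le hx0.le)
  rw [inner_add_left, inner_smul_left, inner_smul_left, real_inner_self_eq_norm_sq] at hup
  simp only [conj_trivial] at hup
  rw [inner_sub_left] at hTy
  have h1 : t * (5 / 8 * ‖x‖) ≤ t * inner ℝ (T x) x :=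
    mul_le_mul_of_nonneg_left (by linarith) ht.1
  have h2 : (1 - t) * (5 / 8 * ‖x‖) ≤ (1 - t) * ‖x‖ ^ 2 :=
    mul_le_mul_of_nonneg_left (by nlinarith) (by linarith [ht.2])
  linarith

variable [FiniteDimensional ℝ E]

theorem ConvexOn.add_inner_sub_le (hψ : ConvexOn ℝ Set.univ ψ) {x v : E}
    (hT : HasGradientAt ψ v x) (y : E) : ψ x + inner ℝ v (y - x) ≤ ψ y := by
  have hc : ConvexOn ℝ Set.univ (ψ ∘ AffineMap.lineMap (k := ℝ) x y) :=
    hψ.comp_affineMap (AffineMap.lineMap x y)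
  have hd : HasDerivAt (ψ ∘ AffineMap.lineMap (k := ℝ) x y) (inner ℝ v (y - x)) 0 := by
    have h1 : HasFDerivAt ψ (InnerProductSpace.toDual ℝ E v)
        (AffineMap.lineMap (k := ℝ) x y 0) := by
      simpa using hT.hasFDerivAt
    simpa using h1.comp_hasDerivAt (0 : ℝ) AffineMap.hasDerivAt_lineMap
  have := hc.le_slope_of_hasDerivAt (Set.mem_univ 0) (Set.mem_univ 1) one_pos hd
  simp [slope_def_field] at this
  linarith

theorem inner_sub_sub_nonneg_of_gradient (hψ : ConvexOn ℝ Set.univ ψ)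
    (hT : ∀ x, HasGradientAt ψ (T x) x) (x y : E) : 0 ≤ inner ℝ (T x - T y) (x - y) := by
  have h1 := hψ.add_inner_sub_le (hT x) y
  have h2 := hψ.add_inner_sub_le (hT y) x
  have h3 : inner ℝ (T x) (y - x) = - inner ℝ (T x) (x - y) := by
    rw [← inner_neg_right, neg_sub]
  rw [inner_sub_left]
  linarith

theorem exists_add_gradient_eq (hψ : ConvexOn ℝ Set.univ ψ)
    (hT : ∀ x, HasGradientAt ψ (T x) x) (z : E) : ∃ x, x + T x = z := by
  let f : E → ℝ := fun x => ψ x + ‖x‖ ^ 2 / 2 - inner ℝ z x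
  have hψc : Continuous ψ := continuous_iff_continuousAt.2 fun x => (hT x).continuousAt
  have hf : Continuous f := by fun_prop
  have hlim : Filter.Tendsto f (Filter.cocompact E) Filter.atTop := by
    have h1 : Filter.Tendsto (fun x : E => ‖x‖) (Filter.cocompact E) Filter.atTop :=
      tendsto_norm_cocompact_atTop
    have h2 : Filter.Tendsto (fun r : ℝ => ψ 0 + r * (r / 2 - ‖T 0 - z‖))
        Filter.atTop Filter.atTop := by
      refine Filter.tendsto_atTop_add_const_left _ _
        (Filter.Tendsto.atTop_mul_atTop₀ Filter.tendsto_id ?_)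
      exact Filter.tendsto_atTop_add_const_right _ (-‖T 0 - z‖)
        (Filter.tendsto_id.atTop_div_const two_pos)
    refine Filter.tendsto_atTop_mono (fun x => ?_) (h2.comp h1)
    have h3 := hψ.add_inner_sub_le (hT 0) x
    have h4 := abs_le.1 (abs_real_inner_le_norm (T 0 - z) x)
    rw [inner_sub_left] at h4
    rw [sub_zero] at h3
    simp only [Function.comp, f]
    nlinarith
  obtain ⟨x, hx⟩ := hf.exists_forall_le hlim
  refine ⟨x, ?_⟩
  have hd : HasFDerivAt f (InnerProductSpace.toDual ℝ E (T x + x - z)) x := by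
    have h1 := (hT x).hasFDerivAt
    have h2 : HasFDerivAt (fun y : E => ‖y‖ ^ 2 / 2) (InnerProductSpace.toDual ℝ E x) x := by
      have := (hasStrictFDerivAt_norm_sq x).hasFDerivAt.mul_const (1 / 2 : ℝ)
      refine (this.congr_fderiv ?_).congr_of_eventuallyEq (.of_forall fun y => ?_)
      · ext v; simp
      · simp [div_eq_mul_inv]
    have h3 : HasFDerivAt (fun y : E => inner ℝ z y) (InnerProductSpace.toDual ℝ E z) x :=
      (InnerProductSpace.toDual ℝ E z).hasFDerivAt
    rw [map_sub, map_add]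
    exact (h1.add h2).sub h3
  have hmin : IsLocalMin f x := Filter.Eventually.of_forall hx
  have := hmin.hasFDerivAt_eq_zero hd
  rw [map_eq_zero_iff _ (InnerProductSpace.toDual ℝ E).injective] at this
  rw [add_comm]
  exact sub_eq_zero.1 this

/-- The resolvent `(id + ∇ψ)⁻¹` of an everywhere differentiable convex function `ψ` is a firmly
nonexpansive gradient field. -/
theorem exists_resolvent (hψ : ConvexOn ℝ Set.univ ψ) (hT : ∀ x, HasGradientAt ψ (T x) x) :
    ∃ (J : E → E) (φ : E → ℝ), (∀ z, J z + T (J z) = z) ∧ (∀ x, J (x + T x) = x) ∧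
      (∀ z w, ‖J z - J w‖ ^ 2 ≤ inner ℝ (J z - J w) (z - w)) ∧
      ∀ z, HasGradientAt φ (J z) z := by
  choose J hJ using exists_add_gradient_eq hψ hT
  have hfirm : ∀ z w, ‖J z - J w‖ ^ 2 ≤ inner ℝ (J z - J w) (z - w) := fun z w => by
    have h := inner_sub_sub_nonneg_of_gradient hψ hT (J z) (J w)
    have h1 : z - w = (J z - J w) + (T (J z) - T (J w)) := by
      nth_rw 1 [← hJ z, ← hJ w]; abel
    rw [h1, inner_add_right, real_inner_self_eq_norm_sq, real_inner_comm]
    linarith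
  let φ : E → ℝ := fun z => inner ℝ z (J z) - ψ (J z) - ‖J z‖ ^ 2 / 2
  have hφ : ∀ z w, φ z + inner ℝ (w - z) (J z) ≤ φ w := fun z w => by
    have h := hψ.add_inner_sub_le (hT (J w)) (J z)
    have h1 : T (J w) = w - J w := eq_sub_of_add_eq' (hJ w)
    have h2 := sq_nonneg ‖J z - J w‖
    rw [@norm_sub_sq_real] at h2
    simp only [h1, inner_sub_left, inner_sub_right, real_inner_self_eq_norm_sq] at h
    simp only [φ, inner_sub_left]
    rw [real_inner_comm] at h2
    linarith
  have hlip : ∀ z w, ‖J z - J w‖ ≤ ‖z - w‖ := fun z w =>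
    norm_le_of_sq_le_inner (hfirm z w)
  refine ⟨J, φ, hJ, fun x => ?_, hfirm, fun z => ?_⟩
  · have h := inner_sub_sub_nonneg_of_gradient hψ hT (J (x + T x)) x
    have h1 : T (J (x + T x)) - T x = -(J (x + T x) - x) := by
      rw [eq_sub_of_add_eq' (hJ (x + T x))]; abel
    rw [h1, inner_neg_left, real_inner_self_eq_norm_sq] at h
    have : ‖J (x + T x) - x‖ = 0 := by nlinarith [norm_nonneg (J (x + T x) - x)]
    exact sub_eq_zero.1 (norm_eq_zero.1 this)
  · rw [hasGradientAt_iff_isLittleO]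
    refine Asymptotics.IsBigO.trans_isLittleO (g := fun w => ‖w - z‖ ^ 2) ?_ ?_
    · refine Asymptotics.isBigO_of_le _ fun w => ?_
      have h1 := hφ z w
      have h2 := hφ w z
      have h3 : inner ℝ (w - z) (J w - J z) ≤ ‖w - z‖ ^ 2 := by
        refine (real_inner_le_norm _ _).trans ?_
        rw [sq]
        exact mul_le_mul_of_nonneg_left (hlip w z) (norm_nonneg _)
      rw [inner_sub_right] at h3
      rw [← neg_sub w z, inner_neg_left] at h2
      rw [real_inner_comm, Real.norm_of_nonneg (by linarith), Real.norm_of_nonneg (by positivity)]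
      linarith
    · exact (Asymptotics.isLittleO_norm_pow_id one_lt_two).comp_tendsto
        (tendsto_sub_nhds_zero_iff.2 Filter.tendsto_id)

theorem LinearMap.IsSymmetric.det_smul_id_add_smul {S : E →ₗ[ℝ] E} (hS : S.IsSymmetric)
    (a b : ℝ) :
    LinearMap.det (a • LinearMap.id + b • S) = ∏ i, (a + b * hS.eigenvalues rfl i) := by
  rw [← LinearMap.det_toMatrix (hS.eigenvectorBasis rfl).toBasis, map_add, map_smul, map_smul,
    hS.toMatrix_eigenvectorBasis, LinearMap.toMatrix_id, ← Matrix.diagonal_one,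
    ← Matrix.diagonal_smul, ← Matrix.diagonal_smul, Matrix.diagonal_add, Matrix.det_diagonal]
  simp

/-- Along the segment between the commuting nonnegative operators `S` and `1 - S`, the determinant
is at least its minimum over the endpoints. -/
theorem min_abs_det_le_abs_det {S : E →L[ℝ] E} (hS : (S : E →ₗ[ℝ] E).IsSymmetric)
    (hfirm : ∀ v, ‖S v‖ ^ 2 ≤ inner ℝ (S v) v) {t : ℝ} (ht : t ∈ Set.Icc (0 : ℝ) 1) :
    min |S.det| |(ContinuousLinearMap.id ℝ E - S).det| ≤
      |((1 - t) • S + t • (ContinuousLinearMap.id ℝ E - S)).det| := by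
  have hl : ∀ i, 0 ≤ hS.eigenvalues rfl i ∧ hS.eigenvalues rfl i ≤ 1 := fun i => by
    have h1 := hfirm (hS.eigenvectorBasis rfl i)
    have h2 : S (hS.eigenvectorBasis rfl i) =
        (hS.eigenvalues rfl i) • hS.eigenvectorBasis rfl i := hS.apply_eigenvectorBasis rfl i
    rw [h2, norm_smul, inner_smul_left, real_inner_self_eq_norm_sq] at h1
    simp only [OrthonormalBasis.norm_eq_one, mul_one, one_pow, Real.norm_eq_abs, sq_abs,
      conj_trivial] at h1
    constructor <;> nlinarith
  have hdet : ∀ (a b : ℝ) (M : E →L[ℝ] E),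
      (M : E →ₗ[ℝ] E) = a • LinearMap.id + b • (S : E →ₗ[ℝ] E) →
      M.det = ∏ i, (a + b * hS.eigenvalues rfl i) := fun a b M hM => by
    rw [← hS.det_smul_id_add_smul, ContinuousLinearMap.det, hM]
  rw [hdet 0 1 S (by simp), hdet 1 (-1) _ (by ext; simp [sub_eq_add_neg]),
    hdet t (1 - 2 * t) _ (by ext v; simp; module)]
  have hp : 0 ≤ ∏ i, (0 + 1 * hS.eigenvalues rfl i) :=
    Finset.prod_nonneg fun i _ => by linarith [(hl i).1]
  have hq : 0 ≤ ∏ i, (1 + -1 * hS.eigenvalues rfl i) :=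
    Finset.prod_nonneg fun i _ => by linarith [(hl i).2]
  rw [abs_of_nonneg hp, abs_of_nonneg hq]
  set m := min (∏ i, (0 + 1 * hS.eigenvalues rfl i)) (∏ i, (1 + -1 * hS.eigenvalues rfl i))
  have hm : 0 ≤ m := le_min hp hq
  calc m = m ^ (1 - t) * m ^ t := by
        rw [← Real.rpow_add' hm (by simp)]; simp
    _ ≤ (∏ i, (0 + 1 * hS.eigenvalues rfl i)) ^ (1 - t) *
          (∏ i, (1 + -1 * hS.eigenvalues rfl i)) ^ t := by
        gcongr
        · linarith [ht.2]
        · exact min_le_left _ _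
        · exact ht.1
        · exact min_le_right _ _
    _ = ∏ i, ((0 + 1 * hS.eigenvalues rfl i) ^ (1 - t) *
          (1 + -1 * hS.eigenvalues rfl i) ^ t) := by
        rw [Finset.prod_mul_distrib, Real.finsetProd_rpow, Real.finsetProd_rpow]
        · intro i _; linarith [(hl i).2]
        · intro i _; linarith [(hl i).1]
    _ ≤ ∏ i, (t + (1 - 2 * t) * hS.eigenvalues rfl i) := by
        refine Finset.prod_le_prod (fun i _ => ?_) fun i _ => ?_
        · exact mul_nonneg (Real.rpow_nonneg (by linarith [(hl i).1]) _)
            (Real.rpow_nonneg (by linarith [(hl i).2]) _)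
        · refine (Real.geom_mean_le_arith_mean2_weighted (by linarith [ht.2]) ht.1
            (by linarith [(hl i).1]) (by linarith [(hl i).2]) (by ring)).trans_eq ?_
          ring
    _ ≤ _ := le_abs_self _

/-- The derivative of a gradient field is symmetric. -/
theorem HasFDerivAt.isSymmetric_of_hasGradientAt {J : E → E} {φ : E → ℝ} {S : E →L[ℝ] E} {z : E}
    (hφ : ∀ z, HasGradientAt φ (J z) z) (hS : HasFDerivAt J S z) :
    (S : E →ₗ[ℝ] E).IsSymmetric := by
  intro v w
  have h := second_derivative_symmetric (fun y => (hφ y).hasFDerivAt)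
    ((InnerProductSpace.toDual ℝ E).toContinuousLinearEquiv.toContinuousLinearMap.hasFDerivAt.comp
      z hS) v w
  simpa [real_inner_comm] using h

/-- A Lipschitz self-map preserves null sets. -/
theorem LipschitzWith.addHaar_image_eq_zero [MeasurableSpace E] [BorelSpace E] (μ : Measure E)
    [μ.IsAddHaarMeasure] {f : E → E} {C : NNReal} (hf : LipschitzWith C f) {s : Set E}
    (hs : μ s = 0) : μ (f '' s) = 0 := by
  let ν : Measure E := Measure.hausdorffMeasure (Module.finrank ℝ E)
  have h1 : ν s = 0 := Measure.absolutelyContinuous_isAddHaarMeasure ν μ hs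
  refine Measure.absolutelyContinuous_isAddHaarMeasure μ ν ?_
  refine le_antisymm ((hf.hausdorffMeasure_image_le (by positivity) s).trans_eq ?_) zero_le
  rw [show (Measure.hausdorffMeasure _ s : ENNReal) = 0 from h1, mul_zero]

/-- Up to a set with null image under the gradient `J`, any measurable set splits into two parts
whose images under `J` and `id - J` have total measure at most that of the image of the whole set
under an interpolant of `J` and `id - J`. -/
theorem exists_splitting_measure_image_le [MeasurableSpace E] [BorelSpace E] (μ : Measure E)
    [μ.IsAddHaarMeasure] {J : E → E} {φ : E → ℝ}
    (hJ : ∀ z w, ‖J z - J w‖ ^ 2 ≤ inner ℝ (J z - J w) (z - w)) (hlip : LipschitzWith 1 J)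
    (hφ : ∀ z, HasGradientAt φ (J z) z) {t : ℝ} (ht : t ∈ Set.Ioo (0 : ℝ) 1)
    {F : Set E} (hF : MeasurableSet F) :
    ∃ G H N : Set E, F = G ∪ H ∪ N ∧ μ (J '' N) = 0 ∧
      μ (J '' G) + μ ((fun z => z - J z) '' H) ≤
        μ ((fun z => (1 - t) • J z + t • (z - J z)) '' F) := by
  let D : Set E := F ∩ {z | DifferentiableAt ℝ J z}
  have hD : MeasurableSet D := hF.inter (measurableSet_of_differentiableAt ℝ J)
  let B : Set E := {z | |(fderiv ℝ J z).det| ≤ |(ContinuousLinearMap.id ℝ E - fderiv ℝ J z).det|}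
  have hB : MeasurableSet B := by
    have h := measurable_fderiv ℝ J
    have hdet : Continuous fun M : E →L[ℝ] E => M.det := ContinuousLinearMap.continuous_det
    exact measurableSet_le (hdet.measurable.comp h).abs
      (hdet.measurable.comp (h.const_sub (ContinuousLinearMap.id ℝ E))).abs
  have hdP : ∀ z ∈ D, HasFDerivAt J (fderiv ℝ J z) z := fun z hz => hz.2.hasFDerivAt
  have hdQ : ∀ z ∈ D, HasFDerivAt (fun z => z - J z)
      (ContinuousLinearMap.id ℝ E - fderiv ℝ J z) z := fun z hz => (hasFDerivAt_id z).sub (hdP z hz)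
  have hdR : ∀ z ∈ D, HasFDerivAt (fun z => (1 - t) • J z + t • (z - J z))
      ((1 - t) • fderiv ℝ J z + t • (ContinuousLinearMap.id ℝ E - fderiv ℝ J z)) z := fun z hz =>
    ((hdP z hz).const_smul (1 - t)).add ((hdQ z hz).const_smul t)
  have hmin : ∀ z ∈ D, min |(fderiv ℝ J z).det| |(ContinuousLinearMap.id ℝ E - fderiv ℝ J z).det| ≤
      |((1 - t) • fderiv ℝ J z + t • (ContinuousLinearMap.id ℝ E - fderiv ℝ J z)).det| :=
    fun z hz => min_abs_det_le_abs_det ((hdP z hz).isSymmetric_of_hasGradientAt hφ)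
      (norm_fderiv_sq_le_inner hJ (hdP z hz)) (Set.Ioo_subset_Icc_self ht)
  have hinj : Function.Injective fun z => (1 - t) • J z + t • (z - J z) := fun z w hzw => by
    have h0 : (1 - t) • (J z - J w) + t • ((z - w) - (J z - J w)) = 0 := by
      rw [← sub_eq_zero.2 hzw]; module
    have h1 := congrArg (inner ℝ (J z - J w)) h0
    rw [inner_add_right, inner_smul_right, inner_smul_right,
      inner_sub_right _ (z - w), real_inner_self_eq_norm_sq, inner_zero_right] at h1
    have h2 : ‖J z - J w‖ ^ 2 = 0 := by
      have := mul_nonneg ht.1.le (sub_nonneg.2 (hJ z w))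
      nlinarith [ht.2, sq_nonneg ‖J z - J w‖]
    have h3 : J z - J w = 0 := by simpa using h2
    rw [h3, smul_zero, zero_add, sub_zero] at h0
    exact sub_eq_zero.1 ((smul_eq_zero.1 h0).resolve_left ht.1.ne')
  refine ⟨D ∩ B, D \ B, F \ D, ?_, ?_, ?_⟩
  · rw [Set.inter_union_sdiff, Set.union_sdiff_cancel Set.inter_subset_left]
  · refine hlip.addHaar_image_eq_zero μ (measure_mono_null ?_ hlip.ae_differentiableAt)
    intro z hz hd
    exact hz.2 ⟨hz.1, hd⟩
  · calc μ (J '' (D ∩ B)) + μ ((fun z => z - J z) '' (D \ B))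
        ≤ (∫⁻ z in D ∩ B, ENNReal.ofReal |((1 - t) • fderiv ℝ J z +
              t • (ContinuousLinearMap.id ℝ E - fderiv ℝ J z)).det| ∂μ) +
            ∫⁻ z in D \ B, ENNReal.ofReal |((1 - t) • fderiv ℝ J z +
              t • (ContinuousLinearMap.id ℝ E - fderiv ℝ J z)).det| ∂μ := by
          refine add_le_add ?_ ?_
          · refine (addHaar_image_le_lintegral_abs_det_fderiv μ (hD.inter hB) fun z hz =>
              (hdP z hz.1).hasFDerivWithinAt).trans (setLIntegral_mono' (hD.inter hB) ?_)
            intro z hz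
            exact ENNReal.ofReal_le_ofReal ((le_min le_rfl hz.2).trans (hmin z hz.1))
          · refine (addHaar_image_le_lintegral_abs_det_fderiv μ (hD.diff hB) fun z hz =>
              (hdQ z hz.1).hasFDerivWithinAt).trans (setLIntegral_mono' (hD.diff hB) ?_)
            intro z hz
            exact ENNReal.ofReal_le_ofReal
              ((le_min (not_le.1 hz.2).le le_rfl).trans (hmin z hz.1))
      _ = μ ((fun z => (1 - t) • J z + t • (z - J z)) '' D) := by
          rw [lintegral_inter_add_sdiff _ _ hB, lintegral_abs_det_fderiv_eq_addHaar_image μ hD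
            (fun z hz => (hdR z hz).hasFDerivWithinAt) hinj.injOn]
      _ ≤ _ := measure_mono (Set.image_mono Set.inter_subset_left)

theorem measurable_of_hasGradientAt [MeasurableSpace E] [BorelSpace E]
    (hT : ∀ x, HasGradientAt ψ (T x) x) : Measurable T := by
  have h : T = fun x => (InnerProductSpace.toDual ℝ E).symm (fderiv ℝ ψ x) := by
    ext1 x
    rw [(hT x).hasFDerivAt.fderiv, LinearIsometryEquiv.symm_apply_apply]
  rw [h]
  exact (InnerProductSpace.toDual ℝ E).symm.continuous.measurable.comp (measurable_fderiv ℝ ψ)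

theorem exists_norm_gradient_le (hψ : ConvexOn ℝ Set.univ ψ) (hT : ∀ x, HasGradientAt ψ (T x) x)
    (R : ℝ) : ∃ C, ∀ x ∈ ball (0 : E) R, ‖T x‖ ≤ C := by
  have hψc : Continuous ψ := continuous_iff_continuousAt.2 fun x => (hT x).continuousAt
  obtain ⟨C, hC⟩ := (isCompact_closedBall (0 : E) (R + 1)).exists_bound_of_continuousOn
    hψc.continuousOn
  refine ⟨2 * C, fun x hx => ?_⟩
  rw [mem_ball_zero_iff] at hx
  have hunit : ‖(‖T x‖⁻¹ • T x)‖ ≤ 1 := by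
    rw [norm_smul, norm_inv, norm_norm]
    exact inv_mul_le_one
  have h := hψ.add_inner_sub_le (hT x) (x + ‖T x‖⁻¹ • T x)
  rw [add_sub_cancel_left, inner_smul_right, real_inner_self_eq_norm_sq] at h
  have h1 : ‖T x‖⁻¹ * ‖T x‖ ^ 2 = ‖T x‖ := by
    rcases eq_or_ne ‖T x‖ 0 with h0 | h0
    · simp [h0]
    · field_simp
  have h2 := abs_le.1 (hC x (by rw [mem_closedBall_zero_iff]; linarith))
  have h3 := abs_le.1 (hC (x + ‖T x‖⁻¹ • T x) (by
    rw [mem_closedBall_zero_iff]; linarith [norm_add_le x (‖T x‖⁻¹ • T x)]))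
  linarith [h2.1, h3.2]

/-- Smallness of the transport energy controls the displacement uniformly in the interior. -/
theorem norm_gradient_sub_id_le [MeasurableSpace E] [BorelSpace E] (μ : Measure E)
    [μ.IsAddHaarMeasure] {ρ : E → ℝ} (hψ : ConvexOn ℝ Set.univ ψ)
    (hT : ∀ x, HasGradientAt ψ (T x) x) (hρc : ContinuousOn ρ (ball 0 1))
    (hρl : ∀ x ∈ ball (0 : E) 1, 1 / 2 ≤ ρ x) (hρu : ∀ x ∈ ball (0 : E) 1, ρ x ≤ 2)
    (henergy : ∫ x in ball (0 : E) 1, ‖T x - x‖ ^ 2 * ρ x ∂μ <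
      1 / 2048 * μ.real (ball (0 : E) (1 / 128)))
    {x : E} (hx : ‖x‖ ≤ 3 / 4) : ‖T x - x‖ ≤ 1 / 8 := by
  by_contra! hlt
  obtain ⟨c, hc, hcT⟩ :=
    exists_ball_le_norm_sub_of_monotone (inner_sub_sub_nonneg_of_gradient hψ hT) hlt
  have hc1 : ball c (1 / 128) ⊆ ball 0 1 := fun y hy => by
    have h := mem_ball_iff_norm.1 (hc hy)
    rw [mem_ball_zero_iff]
    have := norm_add_le (y - x) x
    rw [sub_add_cancel] at this
    linarith
  obtain ⟨C, hC⟩ := exists_norm_gradient_le hψ hT 1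
  have hint : IntegrableOn (fun x => ‖T x - x‖ ^ 2 * ρ x) (ball 0 1) μ := by
    refine IntegrableOn.of_bound measure_ball_lt_top ?_ ((C + 1) ^ 2 * 2) ?_
    · have hTm := measurable_of_hasGradientAt hT
      exact ((hTm.sub measurable_id).norm.pow_const 2).aestronglyMeasurable.mul
        (hρc.aestronglyMeasurable measurableSet_ball)
    · filter_upwards [ae_restrict_mem measurableSet_ball] with y hy
      have h1 := hρl y hy
      have h2 := hρu y hy
      have h3 : ‖T y - y‖ ≤ C + 1 :=
        (norm_sub_le _ _).trans (add_le_add (hC y hy) (mem_ball_zero_iff.1 hy).le)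
      rw [Real.norm_of_nonneg (by positivity)]
      gcongr
  refine henergy.not_ge ?_
  calc 1 / 2048 * μ.real (ball (0 : E) (1 / 128))
      = ∫ _ in ball c (1 / 128), (1 / 2048 : ℝ) ∂μ := by
        rw [setIntegral_const, smul_eq_mul, Measure.addHaar_real_ball_center μ c, mul_comm]
    _ ≤ ∫ y in ball c (1 / 128), ‖T y - y‖ ^ 2 * ρ y ∂μ := by
        refine setIntegral_mono_on (integrableOn_const measure_ball_lt_top.ne)
          (hint.mono_set hc1) measurableSet_ball fun y hy => ?_
        calc (1 / 2048 : ℝ) = (1 / 32) ^ 2 * (1 / 2) := by norm_num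
          _ ≤ _ := by
            have h1 := hcT y hy
            have h2 := hρl y (hc1 hy)
            gcongr
    _ ≤ _ := by
        refine setIntegral_mono_set hint ?_ hc1.eventuallyLE
        filter_upwards [ae_restrict_mem measurableSet_ball] with y hy
        have := hρl y hy
        simp only [Pi.zero_apply]
        positivity

end

theorem MeasureTheory.Measure.withDensity_apply_le_of_subset {X : Type*} [MeasurableSpace X]
    (μ : Measure X) {f : X → ENNReal} {c : ENNReal} {U S : Set X} (hU : MeasurableSet U)
    (hf : ∀ x ∈ U, f x ≤ c) (hS : S ⊆ U) : μ.withDensity f S ≤ c * μ S := by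
  have hV : MeasurableSet (toMeasurable μ S ∩ U) := (measurableSet_toMeasurable μ S).inter hU
  calc μ.withDensity f S ≤ μ.withDensity f (toMeasurable μ S ∩ U) :=
        measure_mono (Set.subset_inter (subset_toMeasurable μ S) hS)
    _ = ∫⁻ x in toMeasurable μ S ∩ U, f x ∂μ := withDensity_apply f hV
    _ ≤ ∫⁻ _ in toMeasurable μ S ∩ U, c ∂μ := setLIntegral_mono' hV fun x hx => hf x hx.2
    _ ≤ c * μ S := by
        rw [setLIntegral_const, ← measure_toMeasurable S]
        gcongr
        exact Set.inter_subset_left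

/-- Displacement convexity of the sup bound, given that the preimage of `A` under the interpolant
and its image under the transport map lie in a set where both densities are at most `c`. -/
theorem map_interpolant_withDensity_le {E : Type*} [NormedAddCommGroup E] [InnerProductSpace ℝ E]
    [FiniteDimensional ℝ E] [MeasurableSpace E] [BorelSpace E] (μ : Measure E)
    [μ.IsAddHaarMeasure] {f₀ f₁ : E → ENNReal} {c : ENNReal} {T : E → E} {ψ : E → ℝ}
    (hψ : ConvexOn ℝ Set.univ ψ) (hT : ∀ x, HasGradientAt ψ (T x) x)
    (hmap : (μ.withDensity f₀).map T = μ.withDensity f₁) {U : Set E} (hU : MeasurableSet U)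
    (hf₀ : ∀ x ∈ U, f₀ x ≤ c) (hf₁ : ∀ x ∈ U, f₁ x ≤ c) {t : ℝ} (ht : t ∈ Set.Icc (0 : ℝ) 1)
    {A : Set E} (hA : MeasurableSet A)
    (hloc : ∀ x, t • T x + (1 - t) • x ∈ A → x ∈ U ∧ T x ∈ U) :
    (μ.withDensity f₀).map (fun x => t • T x + (1 - t) • x) A ≤ c * μ A := by
  have hTm := measurable_of_hasGradientAt hT
  have hRm : Measurable fun x => t • T x + (1 - t) • x :=
    (hTm.const_smul t).add (measurable_id.const_smul (1 - t))
  rcases ht.1.eq_or_lt with rfl | ht0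
  · simp only [zero_smul, zero_add, sub_zero, one_smul] at hloc ⊢
    rw [Measure.map_id']
    exact μ.withDensity_apply_le_of_subset hU hf₀ fun x hx => (hloc x hx).1
  obtain ⟨J, φ, hJT, hTJ, hfirm, hφ⟩ := exists_resolvent hψ hT
  have hTJ' : ∀ z, T (J z) = z - J z := fun z => eq_sub_of_add_eq' (hJT z)
  rcases ht.2.eq_or_lt with rfl | ht1
  · simp only [one_smul, sub_self, zero_smul, add_zero] at hloc ⊢
    calc (μ.withDensity f₀).map T A = (μ.withDensity f₀).map T (A ∩ U) := by
          rw [Measure.map_apply hTm hA, Measure.map_apply hTm (hA.inter hU)]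
          congr 1
          ext x
          exact ⟨fun hx => ⟨hx, (hloc x hx).2⟩, fun hx => hx.1⟩
      _ ≤ c * μ (A ∩ U) := by
          rw [hmap]
          exact μ.withDensity_apply_le_of_subset hU hf₁ Set.inter_subset_right
      _ ≤ c * μ A := by
          gcongr
          exact Set.inter_subset_left
  have hlip : LipschitzWith 1 J := by
    refine LipschitzWith.of_dist_le_mul fun z w => ?_
    rw [dist_eq_norm, dist_eq_norm, NNReal.coe_one, one_mul]
    exact norm_le_of_sq_le_inner (hfirm z w)
  set S : Set E := (fun x => t • T x + (1 - t) • x) ⁻¹' A with hS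
  obtain ⟨G, H, N, hGHN, hN, hle⟩ := exists_splitting_measure_image_le μ hfirm hlip hφ ⟨ht0, ht1⟩
    (hlip.continuous.measurable (hRm hA))
  have hsub : ∀ z ∈ G ∪ H ∪ N, J z ∈ S := fun z hz => by rw [← hGHN] at hz; exact hz
  have hcover : S ⊆ J '' G ∪ J '' H ∪ J '' N := fun x hx => by
    rw [← Set.image_union, ← Set.image_union, ← hGHN]
    exact ⟨x + T x, by rwa [Set.mem_preimage, hTJ], hTJ x⟩
  rw [Measure.map_apply hRm hA]
  have hG : μ.withDensity f₀ (J '' G) ≤ c * μ (J '' G) := by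
    refine μ.withDensity_apply_le_of_subset hU hf₀ ?_
    rintro _ ⟨z, hz, rfl⟩
    exact (hloc _ (hsub z (.inl (.inl hz)))).1
  have hH : μ.withDensity f₀ (J '' H) ≤ c * μ ((fun z => z - J z) '' H) := by
    calc μ.withDensity f₀ (J '' H) ≤ μ.withDensity f₀ (T ⁻¹' ((fun z => z - J z) '' H)) := by
          refine measure_mono ?_
          rintro _ ⟨z, hz, rfl⟩
          exact ⟨z, hz, (hTJ' z).symm⟩
      _ ≤ μ.withDensity f₁ ((fun z => z - J z) '' H) := by
          rw [← hmap]
          exact Measure.le_map_apply hTm.aemeasurable _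
      _ ≤ _ := by
          refine μ.withDensity_apply_le_of_subset hU hf₁ ?_
          rintro _ ⟨z, hz, rfl⟩
          simp only [← hTJ']
          exact (hloc _ (hsub z (.inl (.inr hz)))).2
  have hN0 : μ.withDensity f₀ (J '' N) = 0 := withDensity_absolutelyContinuous μ f₀ hN
  calc μ.withDensity f₀ S
      ≤ μ.withDensity f₀ (J '' G) + μ.withDensity f₀ (J '' H) + μ.withDensity f₀ (J '' N) :=
        (measure_mono hcover).trans ((measure_union_le _ _).trans
          (add_le_add_left (measure_union_le _ _) _))
    _ ≤ c * μ (J '' G) + c * μ ((fun z => z - J z) '' H) := by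
        rw [hN0, add_zero]; exact add_le_add hG hH
    _ ≤ c * μ A := by
        rw [← mul_add]
        gcongr
        refine hle.trans (measure_mono ?_)
        rintro _ ⟨z, hz, rfl⟩
        have : t • T (J z) + (1 - t) • J z ∈ A := hz
        rw [hTJ', add_comm] at this
        exact this

theorem continuousOn_of_abs_sub_le_rpow {E : Type*} [NormedAddCommGroup E] {f : E → ℝ} {s : Set E}
    {C α : ℝ} (hα : 0 < α) (hf : ∀ x ∈ s, ∀ y ∈ s, |f x - f y| ≤ C * ‖x - y‖ ^ α) :
    ContinuousOn f s := by
  intro x hx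
  rw [ContinuousWithinAt, tendsto_iff_dist_tendsto_zero]
  have h : Filter.Tendsto (fun y => C * ‖y - x‖ ^ α) (nhdsWithin x s) (nhds 0) := by
    have hc : Continuous fun y => C * ‖y - x‖ ^ α :=
      continuous_const.mul ((continuous_id.sub continuous_const).norm.rpow_const
        fun _ => .inr hα.le)
    have := (hc.tendsto x).mono_left (nhdsWithin_le_nhds (s := s))
    simpa [Real.zero_rpow hα.ne'] using this
  refine squeeze_zero' (.of_forall fun _ => dist_nonneg) ?_ h
  filter_upwards [self_mem_nhdsWithin] with y hy
  exact hf y hy x hx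

theorem abs_sub_apply_zero_le {E : Type*} [NormedAddCommGroup E] {f : E → ℝ} {C α : ℝ}
    (hα : 0 ≤ α) (hC : 0 ≤ C)
    (hf : ∀ x ∈ ball (0 : E) 1, ∀ y ∈ ball (0 : E) 1, |f x - f y| ≤ C * ‖x - y‖ ^ α)
    {x : E} (hx : x ∈ ball (0 : E) 1) : |f x - f 0| ≤ C := by
  refine (hf x hx 0 (mem_ball_self one_pos)).trans (mul_le_of_le_one_right hC ?_)
  rw [sub_zero]
  exact Real.rpow_le_one (norm_nonneg x) (mem_ball_zero_iff.1 hx).le hα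

/-- Localized McCann displacement convexity: if `ρ₀(0)=ρ₁(0)=1`, `T = ∇ψ` (Brenier map)
pushes `ρ₀` to `ρ₁`, and the transport energy and the Hölder seminorms of the densities
are small enough, then for `t ∈ [0,1]` the interpolant density
`ρ(t,·) = (T_t)_# ρ₀` (with `T_t = tT + (1−t)id`) satisfies
`sup_{B_{1/2}} ρ(t,·) ≤ 1 + [ρ₀]_α + [ρ₁]_α`, stated at the level of measures. -/
theorem stmt11 (d : ℕ) (hd : 1 ≤ d) (α : ℝ) (hα : α ∈ Set.Ioo (0:ℝ) 1) :
    ∃ ε : ℝ, 0 < ε ∧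
      ∀ (ρ₀ ρ₁ : EuclideanSpace ℝ (Fin d) → ℝ)
        (T : EuclideanSpace ℝ (Fin d) → EuclideanSpace ℝ (Fin d))
        (ψ : EuclideanSpace ℝ (Fin d) → ℝ) (γ₀ γ₁ : ℝ),
        (∀ x, 0 ≤ ρ₀ x) → (∀ y, 0 ≤ ρ₁ y) →
        ρ₀ 0 = 1 → ρ₁ 0 = 1 →
        0 ≤ γ₀ → 0 ≤ γ₁ →
        (∀ x ∈ Metric.ball (0 : EuclideanSpace ℝ (Fin d)) 1,
          ∀ y ∈ Metric.ball (0 : EuclideanSpace ℝ (Fin d)) 1,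
            |ρ₀ x - ρ₀ y| ≤ γ₀ * ‖x - y‖ ^ α) →
        (∀ x ∈ Metric.ball (0 : EuclideanSpace ℝ (Fin d)) 1,
          ∀ y ∈ Metric.ball (0 : EuclideanSpace ℝ (Fin d)) 1,
            |ρ₁ x - ρ₁ y| ≤ γ₁ * ‖x - y‖ ^ α) →
        ConvexOn ℝ Set.univ ψ →
        (∀ x, HasGradientAt ψ (T x) x) →
        Measure.map T (volume.withDensity (fun x => ENNReal.ofReal (ρ₀ x))) =
          volume.withDensity (fun y => ENNReal.ofReal (ρ₁ y)) →
        (∫ x in Metric.ball (0 : EuclideanSpace ℝ (Fin d)) 1, ‖T x - x‖ ^ 2 * ρ₀ x) +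
            γ₀ + γ₁ ≤ ε →
        ∀ t ∈ Set.Icc (0:ℝ) 1, ∀ A : Set (EuclideanSpace ℝ (Fin d)),
          MeasurableSet A → A ⊆ Metric.ball (0 : EuclideanSpace ℝ (Fin d)) (1/2) →
          Measure.map (fun x => t • T x + (1 - t) • x)
              (volume.withDensity (fun x => ENNReal.ofReal (ρ₀ x))) A ≤
            ENNReal.ofReal (1 + γ₀ + γ₁) * volume A := by
  have hvol : 0 < volume.real (ball (0 : EuclideanSpace ℝ (Fin d)) (1 / 128)) :=
    ENNReal.toReal_pos (measure_ball_pos _ _ (by norm_num)).ne' measure_ball_lt_top.ne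
  refine ⟨min (1 / 2) (1 / 4096 * volume.real (ball (0 : EuclideanSpace ℝ (Fin d)) (1 / 128))),
    lt_min one_half_pos (mul_pos (by norm_num) hvol), ?_⟩
  intro ρ₀ ρ₁ T ψ γ₀ γ₁ hρ₀_nonneg _ h₀ h₁ hγ₀ hγ₁ hρ₀ hρ₁ hψ hT hmap henergy t ht A hA hAsub
  have hb₀ : ∀ x ∈ ball (0 : EuclideanSpace ℝ (Fin d)) 1, |ρ₀ x - 1| ≤ γ₀ := fun x hx => by
    rw [← h₀]; exact abs_sub_apply_zero_le hα.1.le hγ₀ hρ₀ hx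
  have hb₁ : ∀ x ∈ ball (0 : EuclideanSpace ℝ (Fin d)) 1, |ρ₁ x - 1| ≤ γ₁ := fun x hx => by
    rw [← h₁]; exact abs_sub_apply_zero_le hα.1.le hγ₁ hρ₁ hx
  have henergy_nonneg :
      0 ≤ ∫ x in ball (0 : EuclideanSpace ℝ (Fin d)) 1, ‖T x - x‖ ^ 2 * ρ₀ x :=
    integral_nonneg fun x => mul_nonneg (by positivity) (hρ₀_nonneg x)
  have hε₁ := henergy.trans (min_le_left _ _)
  have hε₂ := henergy.trans (min_le_right _ _)
  have hdisp : ∀ x : EuclideanSpace ℝ (Fin d), ‖x‖ ≤ 3 / 4 → ‖T x - x‖ ≤ 1 / 8 := fun x hx =>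
    norm_gradient_sub_id_le volume hψ hT (continuousOn_of_abs_sub_le_rpow hα.1 hρ₀)
      (fun y hy => by linarith [(abs_le.1 (hb₀ y hy)).1])
      (fun y hy => by linarith [(abs_le.1 (hb₀ y hy)).2]) (by linarith) hx
  refine map_interpolant_withDensity_le volume hψ hT hmap measurableSet_ball
    (fun x hx => ENNReal.ofReal_le_ofReal ?_) (fun x hx => ENNReal.ofReal_le_ofReal ?_) ht hA
    (U := ball 0 1) fun x hx => ?_
  · linarith [(abs_le.1 (hb₀ x hx)).2]
  · linarith [(abs_le.1 (hb₁ x hx)).2]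
  · have hx' := norm_lt_of_interpolant_mem_ball (inner_sub_sub_nonneg_of_gradient hψ hT) hdisp ht
      (mem_ball_zero_iff.1 (hAsub hx))
    have h := norm_add_le (T x - x) x
    rw [sub_add_cancel] at h
    rw [mem_ball_zero_iff, mem_ball_zero_iff]
    constructor <;> linarith [hdisp x hx'.le]
end
end
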